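/- Let T be a tree of order at least 3. Then gpg'(T) = ℓ(T) − Δ(T) + 2 if and only if T belongs to the family 𝒯, where ℓ(T) is the number of leaves of T and Δ(T) is the maximum degree of T. -/

import Mathlib

open Finset SimpleGraph

variable {V : Type*}

/-- `S` is in general position in `G`: no shortest path of `G` contains more than
two vertices of `S`. -/
def IsGPSet (G : SimpleGraph V) (S : Set V) : Prop :=
  ∀ ⦃u v : V⦄ (p : G.Walk u v), p.IsPath → p.length = G.dist u v →
    (S ∩ {x | x ∈ p.support}).ncard ≤ 2

open scoped Classical in
/-- The set of vertices that can legally be played when the set of already selected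
vertices is `S`. -/
noncomputable def playable [Fintype V] (G : SimpleGraph V) (S : Finset V) : Finset V :=
  Finset.univ.filter (fun v => v ∉ S ∧ IsGPSet G (↑(insert v S) : Set V))

open scoped Classical in
/-- Value (final set size with optimal play) of the Builder-Blocker general position game
from position `S` with the given player to move (`true` = Builder, the maximiser;
`false` = Blocker, the minimiser), computed with a fuel parameter. -/
noncomputable def gameValAux [Fintype V] (G : SimpleGraph V) : ℕ → Bool → Finset V → ℕ
  | 0, _, S => S.card
  | fuel + 1, turn, S =>
    if h : (playable G S).Nonempty then
      if turn then (playable G S).sup' h (fun v => gameValAux G fuel (!turn) (insert v S))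
      else (playable G S).inf' h (fun v => gameValAux G fuel (!turn) (insert v S))
    else S.card

/-- Value of the Builder-Blocker general position game from position `S`,
with `turn = true` meaning Builder (the maximiser) is to move. Since at most
`Fintype.card V - S.card` further moves are possible, this fuel suffices. -/
noncomputable def gameVal [Fintype V] (G : SimpleGraph V) (turn : Bool) (S : Finset V) : ℕ :=
  gameValAux G (Fintype.card V - S.card) turn S

/-- The B-game general position number: Builder moves first. -/
noncomputable def gpg [Fintype V] (G : SimpleGraph V) : ℕ := gameVal G true ∅

/-- The B'-game general position number: Blocker moves first. -/
noncomputable def gpg' [Fintype V] (G : SimpleGraph V) : ℕ := gameVal G false ∅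

open scoped Classical in
/-- The number of leaves of `G`. -/
noncomputable def leafCount [Fintype V] (G : SimpleGraph V) : ℕ :=
  (Finset.univ.filter fun v => G.degree v = 1).card

open scoped Classical in
/-- The maximum degree of `G`. -/
noncomputable def maxDeg [Fintype V] (G : SimpleGraph V) : ℕ :=
  Finset.univ.sup fun v => G.degree v

/-- Base relation for the general model of trees in the family `𝒯` (and their
subdivisions): a central path on `Fin K`, with `s i` pendant paths attached at the `i`-th
path vertex, the `j`-th of which has length `L i j`. -/
def GenModelRel (K : ℕ) (s : Fin K → ℕ) (L : (i : Fin K) → Fin (s i) → ℕ) :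
    (Fin K ⊕ Σ i : Fin K, Σ j : Fin (s i), Fin (L i j)) →
    (Fin K ⊕ Σ i : Fin K, Σ j : Fin (s i), Fin (L i j)) → Prop
  | Sum.inl i, Sum.inl i' => (i' : ℕ) = (i : ℕ) + 1
  | Sum.inl i, Sum.inr ⟨i', _, a⟩ => i = i' ∧ (a : ℕ) = 0
  | Sum.inr ⟨i, j, a⟩, Sum.inr ⟨i', j', a'⟩ =>
      (i : ℕ) = (i' : ℕ) ∧ (j : ℕ) = (j' : ℕ) ∧ (a' : ℕ) = (a : ℕ) + 1
  | _, _ => False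

/-- A caterpillar-like tree: a central path on `Fin K` with `s i` pendant paths of
lengths `L i ·` attached at the `i`-th vertex of the path. -/
def GenModel (K : ℕ) (s : Fin K → ℕ) (L : (i : Fin K) → Fin (s i) → ℕ) :
    SimpleGraph (Fin K ⊕ Σ i : Fin K, Σ j : Fin (s i), Fin (L i j)) :=
  SimpleGraph.fromRel (GenModelRel K s L)

/-- Membership in the family `𝒯`: either `G` is a star `K_{1,n}` with `n ≥ 2`, or `G` is
obtained from a tree `T_{t₁,…,t_k} ∈ 𝒯'` by subdividing its edges arbitrarily.  The
latter is expressed via the general model: a central path whose endpoints carry the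
pendant paths of `u₁` and `u_k` (subdivided leaf edges, of positive lengths), interior
vertices carrying the remaining (possibly zero) pendant paths, subject to `s 0 ≥ 1`
(i.e. `t₁ ≥ 1`) and `s (K-1) ≥ ∑_{i < K-1} s i` (i.e. `t_k ≥ t₁ + ⋯ + t_{k-1}`). -/
def InTFamily {W : Type*} (G : SimpleGraph W) : Prop :=
  (∃ n : ℕ, 2 ≤ n ∧ Nonempty (G ≃g GenModel 1 (fun _ => n) (fun _ _ => 1))) ∨
  (∃ (K : ℕ) (hK : 2 ≤ K) (s : Fin K → ℕ) (L : (i : Fin K) → Fin (s i) → ℕ),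
    (∀ i j, 1 ≤ L i j) ∧ 1 ≤ s ⟨0, by omega⟩ ∧
    (∑ i ∈ Finset.univ.filter (fun i : Fin K => (i : ℕ) < K - 1), s i) ≤ s ⟨K - 1, by omega⟩ ∧
    Nonempty (G ≃g GenModel K s L))

section TreeMetric

/-- `b` lies on a geodesic from `a` to `c`. -/
def OnGeod (T : SimpleGraph V) (a b c : V) : Prop := T.dist a b + T.dist b c = T.dist a c

variable {T : SimpleGraph V}

lemma OnGeod.symm {a b c : V} (h : OnGeod T a b c) : OnGeod T c b a := by
  unfold OnGeod at *
  rw [T.dist_comm (u := c) (v := b), T.dist_comm (u := b) (v := a), T.dist_comm (u := c) (v := a)]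
  omega

lemma onGeod_left (a c : V) : OnGeod T a a c := by simp [OnGeod]

lemma onGeod_right (a c : V) : OnGeod T a c c := by simp [OnGeod]

lemma OnGeod.trans (hT : T.IsTree) {r a b c : V} (h : OnGeod T r a b) (h' : OnGeod T r b c) :
    OnGeod T r a c := by
  unfold OnGeod at *
  have h1 := hT.connected.dist_triangle (u := r) (v := a) (w := c)
  have h2 := hT.connected.dist_triangle (u := a) (v := b) (w := c)
  omega

lemma OnGeod.trans_right (hT : T.IsTree) {r a b c : V} (h : OnGeod T r a b) (h' : OnGeod T r b c) :
    OnGeod T a b c := by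
  have := h.trans hT h'
  unfold OnGeod at *
  omega

lemma OnGeod.eq_of_dist_le (hT : T.IsTree) {r a b : V} (h : OnGeod T r a b)
    (h' : T.dist r b ≤ T.dist r a) : a = b := by
  unfold OnGeod at h
  exact hT.connected.dist_eq_zero_iff.1 (by omega)

lemma OnGeod.antisymm (hT : T.IsTree) {r a b : V} (h : OnGeod T r a b)
    (h' : OnGeod T r b a) : a = b :=
  h.eq_of_dist_le hT (by unfold OnGeod at h'; omega)

lemma SimpleGraph.IsTree.dist_adj_cases (hT : T.IsTree) (r : V) {a b : V} (h : T.Adj a b) :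
    T.dist r a = T.dist r b + 1 ∨ T.dist r b = T.dist r a + 1 :=
  hT.dist_eq_dist_add_one_of_adj r h

lemma onGeod_of_adj {r a b : V} (h : T.Adj a b) (hd : T.dist r b = T.dist r a + 1) :
    OnGeod T r a b := by
  simp [OnGeod, dist_eq_one_iff_adj.2 h, hd]

lemma exists_parent (hT : T.IsTree) {r a : V} (h : a ≠ r) :
    ∃ c, T.Adj a c ∧ T.dist r a = T.dist r c + 1 := by
  obtain ⟨p, hp⟩ := hT.connected.exists_walk_length_eq_dist a r
  cases p with
  | nil => exact absurd rfl h
  | cons hadj q =>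
    rename_i c
    refine ⟨c, hadj, ?_⟩
    have h1 := T.dist_le q
    rw [Walk.length_cons] at hp
    have h2 := hT.dist_adj_cases r hadj
    rw [T.dist_comm (u := c)] at h1
    rw [T.dist_comm (u := a)] at hp
    omega

lemma parent_unique (hT : T.IsTree) {r a c c' : V} (h : T.Adj a c) (h' : T.Adj a c')
    (hc : T.dist r a = T.dist r c + 1) (hc' : T.dist r a = T.dist r c' + 1) : c = c' := by
  obtain ⟨p, hp⟩ := hT.connected.exists_walk_length_eq_dist r c
  obtain ⟨q, hq⟩ := hT.connected.exists_walk_length_eq_dist r c'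
  have h1 : (p.concat h.symm).IsPath := Walk.isPath_of_length_eq_dist _ (by simp; omega)
  have h2 : (q.concat h'.symm).IsPath := Walk.isPath_of_length_eq_dist _ (by simp; omega)
  have h3 := hT.existsUnique_path r a
  have h4 := congrArg Walk.penultimate (h3.unique h1 h2)
  simpa using h4

lemma onGeod_total (hT : T.IsTree) {r a a' l : V} (h : OnGeod T r a l) (h' : OnGeod T r a' l) :
    OnGeod T r a a' ∨ OnGeod T r a' a := by
  induction hn : T.dist r l generalizing l with
  | zero =>
    left
    have : r = a := hT.connected.dist_eq_zero_iff.1 (by unfold OnGeod at h; omega)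
    subst this
    exact onGeod_left _ _
  | succ n ih =>
    have step : ∀ b, OnGeod T r b l → b ≠ l → ∃ c, T.Adj l c ∧ T.dist r l = T.dist r c + 1 ∧
        OnGeod T r b c := by
      intro b hb hbl
      obtain ⟨c, hc, hd⟩ := exists_parent hT hbl.symm
      refine ⟨c, hc, ?_⟩
      have h1 := hT.connected.dist_triangle (u := r) (v := b) (w := c)
      have h2 := hT.dist_adj_cases r hc
      unfold OnGeod at *
      omega
    by_cases ha : a = l
    · subst ha; exact Or.inr h'
    by_cases ha' : a' = l
    · subst ha'; exact Or.inl h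
    obtain ⟨c, hc, hd, hb⟩ := step a h ha
    obtain ⟨c', hc', hd', hb'⟩ := step a' h' ha'
    obtain rfl := parent_unique hT hc hc' hd hd'
    exact ih hb hb' (by omega)

lemma onGeod_of_steps (hT : T.IsTree) {a c w : V} (hac : T.Adj a c)
    (hw : T.dist w c = T.dist w a + 1) {u : V} (hu : OnGeod T a c u) : OnGeod T w a u := by
  have key : T.dist w u = T.dist w a + T.dist a u ∧
      ∀ y, T.Adj u y → T.dist a u = T.dist a y + 1 → T.dist w u = T.dist w y + 1 := by
    have h1 : T.dist a c = 1 := dist_eq_one_iff_adj.2 hac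
    induction hn : T.dist c u generalizing u with
    | zero =>
      obtain rfl := hT.connected.dist_eq_zero_iff.1 hn
      refine ⟨by omega, fun y hy hd => ?_⟩
      have : a = y := hT.connected.dist_eq_zero_iff.1 (by omega)
      subst this
      omega
    | succ n ih =>
      have hne : u ≠ c := by rintro rfl; simp at hn
      obtain ⟨y, hy, hd⟩ := exists_parent hT hne
      have t1 := hT.connected.dist_triangle (u := a) (v := c) (w := y)
      have t2 := hT.dist_adj_cases a hy
      have hu' : OnGeod T a c y := by unfold OnGeod at *; omega
      obtain ⟨i1, i2⟩ := ih hu' (by omega)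
      have hwy : T.dist w u = T.dist w y + 1 := by
        rcases hT.dist_adj_cases w hy with h | h
        · exact h
        · exfalso
          have hya : y ≠ a := by
            rintro rfl
            unfold OnGeod at hu'
            rw [T.dist_self] at hu'
            omega
          obtain ⟨z, hz, hzd⟩ := exists_parent hT hya
          have := parent_unique hT hz hy.symm (i2 z hz hzd) h
          subst this
          unfold OnGeod at *
          omega
      have hay : T.dist a u = T.dist a y + 1 := by unfold OnGeod at *; omega
      refine ⟨by omega, fun z hz hzd => ?_⟩
      obtain rfl := parent_unique hT hz hy hzd hay
      exact hwy
  unfold OnGeod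
  omega

/-- A vertex separating `x` from `y` separates any vertex `r` from `x` or from `y`. -/
lemma onGeod_split (hT : T.IsTree) {x a y : V} (h : OnGeod T x a y) (r : V) :
    OnGeod T r a x ∨ OnGeod T r a y := by
  by_cases hx : x = a
  · subst hx; exact Or.inl (onGeod_right _ _)
  by_cases hy : y = a
  · subst hy; exact Or.inr (onGeod_right _ _)
  by_cases hr : r = a
  · subst hr; exact Or.inl (onGeod_left _ _)
  have next : ∀ z, z ≠ a → ∃ c, T.Adj a c ∧ OnGeod T a c z ∧ T.dist z a = T.dist z c + 1 := by
    intro z hz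
    obtain ⟨c, hc, hd⟩ := exists_parent hT (r := z) hz.symm
    exact ⟨c, hc, (onGeod_of_adj hc.symm hd).symm, hd⟩
  obtain ⟨c, hc, hcx, hdx⟩ := next x hx
  obtain ⟨c', hc', hcy, hdy⟩ := next y hy
  have hne : c ≠ c' := by
    rintro rfl
    have h1 := hT.connected.dist_triangle (u := x) (v := c) (w := y)
    rw [T.dist_comm (u := c)] at h1
    unfold OnGeod at h
    rw [T.dist_comm (u := a)] at h
    omega
  rcases hT.dist_adj_cases r hc with h1 | h1
  · rcases hT.dist_adj_cases r hc' with h2 | h2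
    · exact absurd (parent_unique hT hc hc' h1 h2) hne
    · exact Or.inr (onGeod_of_steps hT hc' h2 hcy)
  · exact Or.inl (onGeod_of_steps hT hc h1 hcx)

lemma dist_of_nonbacktracking (hT : T.IsTree) (p : ℕ → V) (n : ℕ)
    (h1 : ∀ i, i < n → T.Adj (p i) (p (i + 1)))
    (h2 : ∀ i, i + 2 ≤ n → p i ≠ p (i + 2)) : ∀ i, i ≤ n → T.dist (p 0) (p i) = i := by
  have : ∀ i, i + 1 ≤ n → T.dist (p 0) (p i) = i ∧ T.dist (p 0) (p (i + 1)) = i + 1 := by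
    intro i
    induction i with
    | zero => intro h; simpa using dist_eq_one_iff_adj.2 (h1 0 (by omega))
    | succ i ih =>
      intro h
      obtain ⟨a, b⟩ := ih (by omega)
      refine ⟨b, ?_⟩
      have adj := h1 (i + 1) (by omega)
      rcases hT.dist_adj_cases (p 0) adj with hd | hd
      · exact absurd (parent_unique hT (h1 i (by omega)).symm adj (by omega) hd) (h2 i (by omega))
      · omega
  intro i hi
  cases i with
  | zero => simp
  | succ i => exact (this i hi).2

lemma exists_geodesic (hT : T.IsTree) (a b : V) : ∃ p : ℕ → V, p 0 = a ∧ p (T.dist a b) = b ∧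
    (∀ i, i < T.dist a b → T.Adj (p i) (p (i + 1))) ∧
    ∀ i, i ≤ T.dist a b → T.dist a (p i) = i ∧ OnGeod T a (p i) b := by
  obtain ⟨q, hq⟩ := hT.connected.exists_walk_length_eq_dist a b
  refine ⟨q.getVert, by simp, by simp [← hq], ?_, ?_⟩
  · intro i hi
    exact q.adj_getVert_succ (by omega)
  · intro i hi
    have h1 := T.dist_le (q.take i)
    have h2 := T.dist_le (q.drop i)
    have h3 := hT.connected.dist_triangle (u := a) (v := q.getVert i) (w := b)
    simp only [Walk.take_length, Walk.drop_length] at h1 h2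
    unfold OnGeod
    omega

lemma eq_of_onGeod_of_dist_eq (hT : T.IsTree) {r a b l : V} (ha : OnGeod T r a l)
    (hb : OnGeod T r b l) (h : T.dist r a = T.dist r b) : a = b := by
  rcases onGeod_total hT ha hb with h' | h'
  · exact h'.eq_of_dist_le hT h.ge
  · exact (h'.eq_of_dist_le hT h.le).symm

/-- In a tree, a set is in general position iff no element of it lies between two others. -/
lemma isGPSet_iff (hT : T.IsTree) [Finite V] (S : Set V) : IsGPSet T S ↔
    ∀ a ∈ S, ∀ b ∈ S, ∀ c ∈ S, a ≠ b → b ≠ c → a ≠ c → ¬ OnGeod T a b c := by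
  classical
  constructor
  · intro h a ha b hb c hc hab hbc hac hbtw
    obtain ⟨p, hp⟩ := hT.connected.exists_walk_length_eq_dist a b
    obtain ⟨q, hq⟩ := hT.connected.exists_walk_length_eq_dist b c
    have hl : (p.append q).length = T.dist a c := by
      rw [Walk.length_append, hp, hq]; exact hbtw
    have h1 := h (p.append q) (Walk.isPath_of_length_eq_dist _ hl) hl
    have h2 : ({a, b, c} : Set V) ⊆ S ∩ {x | x ∈ (p.append q).support} := by
      rintro x (rfl | rfl | rfl)
      · exact ⟨ha, by simp⟩
      · exact ⟨hb, by simp⟩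
      · exact ⟨hc, by simp⟩
    have h3 := Set.ncard_le_ncard h2 (Set.toFinite _)
    have h4 : ({a, b, c} : Set V).ncard = 3 := by
      rw [Set.ncard_eq_three]; exact ⟨a, b, c, hab, hac, hbc, rfl⟩
    omega
  · intro h u v p _ hl
    by_contra hcon
    push Not at hcon
    rw [Set.two_lt_ncard] at hcon
    obtain ⟨a, ⟨ha, hap⟩, b, ⟨hb, hbp⟩, c, ⟨hc, hcp⟩, hab, hac, hbc⟩ := hcon
    have hbt : ∀ x ∈ p.support, OnGeod T u x v := by
      intro x hx
      have h1 := T.dist_le (p.takeUntil x hx)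
      have h2 := T.dist_le (p.dropUntil x hx)
      have h3 := congrArg Walk.length (p.take_spec hx)
      have h4 := hT.connected.dist_triangle (u := u) (v := x) (w := v)
      rw [Walk.length_append] at h3
      unfold OnGeod
      omega
    have key : ∀ x ∈ p.support, ∀ y ∈ p.support, T.dist u x ≤ T.dist u y → OnGeod T u x y := by
      intro x hx y hy hd
      rcases onGeod_total hT (hbt x hx) (hbt y hy) with h' | h'
      · exact h'
      · rw [h'.eq_of_dist_le hT hd]; exact onGeod_right _ _
    have mid : ∀ x ∈ p.support, ∀ y ∈ p.support, ∀ z ∈ p.support, T.dist u x ≤ T.dist u y →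
        T.dist u y ≤ T.dist u z → OnGeod T x y z := by
      intro x hx y hy z hz h1 h2
      exact (key x hx y hy h1).trans_right hT (key y hy z hz h2)
    rcases le_total (T.dist u a) (T.dist u b) with h1 | h1 <;>
    rcases le_total (T.dist u b) (T.dist u c) with h2 | h2 <;>
    rcases le_total (T.dist u a) (T.dist u c) with h3 | h3
    · exact h a ha b hb c hc hab hbc hac (mid a hap b hbp c hcp h1 h2)
    · exact h a ha b hb c hc hab hbc hac (mid a hap b hbp c hcp h1 h2)
    · exact h a ha c hc b hb hac hbc.symm hab (mid a hap c hcp b hbp h3 h2)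
    · exact h c hc a ha b hb hac.symm hab hbc.symm (mid c hcp a hap b hbp h3 h1)
    · exact h b hb a ha c hc hab.symm hac hbc (mid b hbp a hap c hcp h1 h3)
    · exact h b hb c hc a ha hbc hac.symm hab.symm (mid b hbp c hcp a hap h2 h3)
    · exact h c hc b hb a ha hbc.symm hab.symm hac.symm (mid c hcp b hbp a hap h2 h1)
    · exact h c hc b hb a ha hbc.symm hab.symm hac.symm (mid c hcp b hbp a hap h2 h1)

end TreeMetric

section Leaves

variable {T : SimpleGraph V}

lemma exists_next (hT : T.IsTree) {a b : V} (h : a ≠ b) : ∃ c, T.Adj a c ∧ OnGeod T a c b := by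
  obtain ⟨c, hc, hd⟩ := exists_parent hT h
  exact ⟨c, hc, (onGeod_of_adj hc.symm hd).symm⟩

lemma dist_of_next {a b c : V} (h : T.Adj a c) (hc : OnGeod T a c b) :
    T.dist b a = T.dist b c + 1 := by
  have h1 : T.dist a c = 1 := dist_eq_one_iff_adj.2 h
  rw [T.dist_comm (u := b) (v := a), T.dist_comm (u := b) (v := c)]
  unfold OnGeod at hc
  omega

lemma next_unique (hT : T.IsTree) {a b c c' : V} (h : T.Adj a c) (h' : T.Adj a c')
    (hc : OnGeod T a c b) (hc' : OnGeod T a c' b) : c = c' :=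
  parent_unique hT h h' (dist_of_next h hc) (dist_of_next h' hc')

lemma onGeod_of_next_ne (hT : T.IsTree) {a x y c c' : V} (h : T.Adj a c) (h' : T.Adj a c')
    (hc : OnGeod T a c x) (hc' : OnGeod T a c' y) (hne : c ≠ c') : OnGeod T x a y := by
  rcases hT.dist_adj_cases x h' with h1 | h1
  · exact absurd (parent_unique hT h h' (dist_of_next h hc) h1) hne
  · exact onGeod_of_steps hT h' h1 hc'

lemma onGeod_or_of_adj (hT : T.IsTree) (r : V) {a c : V} (h : T.Adj a c) :
    OnGeod T r a c ∨ OnGeod T a c r := by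
  rcases hT.dist_adj_cases r h with h1 | h1
  · exact Or.inr (onGeod_of_adj h.symm h1).symm
  · exact Or.inl (onGeod_of_adj h h1)

lemma onGeod_self_iff (hT : T.IsTree) {a c : V} : OnGeod T a c a ↔ c = a := by
  unfold OnGeod
  rw [T.dist_comm (u := c), T.dist_self]
  constructor
  · intro h; exact (hT.connected.dist_eq_zero_iff.1 (by omega : T.dist a c = 0)).symm
  · rintro rfl; simp

lemma not_onGeod_both (hT : T.IsTree) {r a c : V} (h : a ≠ c) (h1 : OnGeod T r a c) :
    ¬ OnGeod T a c r := fun h2 => h (h1.antisymm hT h2.symm)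

lemma not_onGeod_siblings (hT : T.IsTree) {r b c c' : V} (hc : T.Adj b c) (hc' : T.Adj b c')
    (h : OnGeod T r b c) (h' : OnGeod T r b c') (hne : c ≠ c') : ¬ OnGeod T r c c' := by
  intro hcon
  apply hne
  apply hcon.eq_of_dist_le hT
  have h1 : T.dist b c = 1 := dist_eq_one_iff_adj.2 hc
  have h2 : T.dist b c' = 1 := dist_eq_one_iff_adj.2 hc'
  unfold OnGeod at h h'
  omega

lemma ne_of_child (hT : T.IsTree) {r b c : V} (hc : T.Adj b c) (h : OnGeod T r b c) : c ≠ r := by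
  rintro rfl
  exact hc.ne ((onGeod_self_iff hT).1 h)

variable [Fintype V]

open scoped Classical in
lemma leaf_mid (hT : T.IsTree) {l a b : V} (hl : T.degree l = 1) (h : OnGeod T a l b) :
    a = l ∨ b = l := by
  by_contra! hcon
  obtain ⟨c, hc, hca⟩ := exists_next hT hcon.1.symm
  obtain ⟨c', hc', hcb⟩ := exists_next hT hcon.2.symm
  obtain ⟨d, -, hd⟩ := (degree_eq_one_iff_existsUnique_adj).1 hl
  obtain rfl : c = c' := (hd c hc).trans (hd c' hc').symm
  have h1 := dist_of_next hc hca
  have h2 := dist_of_next hc hcb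
  have h3 := hT.connected.dist_triangle (u := a) (v := c) (w := b)
  unfold OnGeod at h
  rw [T.dist_comm (u := c)] at h3
  rw [T.dist_comm (u := l)] at h
  omega

open scoped Classical in
/-- The leaves `l` such that `a` lies on the path from `r` to `l`. -/
noncomputable def leavesBeyond (T : SimpleGraph V) (r a : V) : Finset V :=
  Finset.univ.filter fun l => T.degree l = 1 ∧ OnGeod T r a l

open scoped Classical in
lemma mem_leavesBeyond {r a l : V} :
    l ∈ leavesBeyond T r a ↔ T.degree l = 1 ∧ OnGeod T r a l := by
  simp [leavesBeyond]

lemma leavesBeyond_mono (hT : T.IsTree) {r a b : V} (h : OnGeod T r a b) :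
    leavesBeyond T r b ⊆ leavesBeyond T r a := by
  intro l hl
  rw [mem_leavesBeyond] at *
  exact ⟨hl.1, h.trans hT hl.2⟩

lemma disjoint_leavesBeyond (hT : T.IsTree) {r a b : V} (h : ¬ OnGeod T r a b)
    (h' : ¬ OnGeod T r b a) : Disjoint (leavesBeyond T r a) (leavesBeyond T r b) := by
  rw [Finset.disjoint_left]
  intro l hl hl'
  rw [mem_leavesBeyond] at *
  rcases onGeod_total hT hl.2 hl'.2 with h1 | h1
  · exact h h1
  · exact h' h1

lemma disjoint_leavesBeyond_siblings (hT : T.IsTree) {r b c c' : V} (hc : T.Adj b c)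
    (hc' : T.Adj b c') (h : OnGeod T r b c) (h' : OnGeod T r b c') (hne : c ≠ c') :
    Disjoint (leavesBeyond T r c) (leavesBeyond T r c') :=
  disjoint_leavesBeyond hT (not_onGeod_siblings hT hc hc' h h' hne)
    (not_onGeod_siblings hT hc' hc h' h hne.symm)

open scoped Classical in
lemma leavesBeyond_nonempty (hT : T.IsTree) {r a : V} (h : a ≠ r) :
    (leavesBeyond T r a).Nonempty := by
  obtain ⟨l, hl, hmax⟩ := Finset.exists_max_image (Finset.univ.filter fun l => OnGeod T r a l)
    (fun l => T.dist r l) ⟨a, by simp [onGeod_right]⟩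
  simp only [Finset.mem_filter, Finset.mem_univ, true_and] at hl hmax
  have hlr : l ≠ r := by
    rintro rfl
    exact h ((onGeod_self_iff hT).1 hl)
  refine ⟨l, mem_leavesBeyond.2 ⟨?_, hl⟩⟩
  obtain ⟨c, hc, hcl⟩ := exists_next hT hlr
  rw [degree_eq_one_iff_existsUnique_adj]
  refine ⟨c, hc, fun z hz => ?_⟩
  rcases onGeod_or_of_adj hT r hz with h1 | h1
  · have h2 := hmax z (hl.trans hT h1)
    exact absurd (h1.eq_of_dist_le hT h2) hz.ne
  · exact next_unique hT hz hc h1 hcl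

open scoped Classical in
lemma three_le_degree {b x y z : V} (hx : T.Adj b x) (hy : T.Adj b y) (hz : T.Adj b z)
    (hxy : x ≠ y) (hxz : x ≠ z) (hyz : y ≠ z) : 3 ≤ T.degree b := by
  rw [← Finset.card_eq_three.2 ⟨x, y, z, hxy, hxz, hyz, rfl⟩, ← card_neighborFinset_eq_degree]
  apply Finset.card_le_card
  intro w hw
  simp only [Finset.mem_insert, Finset.mem_singleton] at hw
  rcases hw with rfl | rfl | rfl <;> simpa

open scoped Classical in
lemma exists_two_children (hT : T.IsTree) {r b : V} (hb : 3 ≤ T.degree b) :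
    ∃ c c', T.Adj b c ∧ T.Adj b c' ∧ OnGeod T r b c ∧ OnGeod T r b c' ∧ c ≠ c' := by
  have key : ∃ w, ∀ c, T.Adj b c → c ≠ w → OnGeod T r b c := by
    by_cases hbr : b = r
    · subst hbr; exact ⟨b, fun c _ _ => onGeod_left _ _⟩
    · obtain ⟨w, hw, hwr⟩ := exists_next hT hbr
      refine ⟨w, fun c hc hne => ?_⟩
      rcases onGeod_or_of_adj hT r hc with h1 | h1
      · exact h1
      · exact absurd (next_unique hT hc hw h1 hwr) hne
  obtain ⟨w, hw⟩ := key
  have h1 : 1 < ((T.neighborFinset b).erase w).card := by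
    have := Finset.pred_card_le_card_erase (s := T.neighborFinset b) (a := w)
    rw [card_neighborFinset_eq_degree] at this
    omega
  obtain ⟨c, hc, c', hc', hne⟩ := Finset.one_lt_card.1 h1
  simp only [Finset.mem_erase, mem_neighborFinset] at hc hc'
  exact ⟨c, c', hc.2, hc'.2, hw c hc.2 hc.1, hw c' hc'.2 hc'.1, hne⟩

open scoped Classical in
lemma two_le_card_leavesBeyond (hT : T.IsTree) {r b : V} (hb : 3 ≤ T.degree b) :
    2 ≤ (leavesBeyond T r b).card := by
  obtain ⟨c, c', hc, hc', h, h', hne⟩ := exists_two_children hT (r := r) hb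
  have h1 := (leavesBeyond_nonempty hT (ne_of_child hT hc h)).card_pos
  have h2 := (leavesBeyond_nonempty hT (ne_of_child hT hc' h')).card_pos
  have h3 := Finset.card_union_of_disjoint (disjoint_leavesBeyond_siblings hT hc hc' h h' hne)
  have h4 := Finset.card_le_card (Finset.union_subset (leavesBeyond_mono hT h)
    (leavesBeyond_mono hT h'))
  omega

open scoped Classical in
lemma exists_branch (hT : T.IsTree) {r a : V} (ha : a ≠ r) (h : 2 ≤ (leavesBeyond T r a).card) :
    ∃ b, 3 ≤ T.degree b ∧ OnGeod T r a b := by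
  obtain ⟨l, hl, l', hl', hne⟩ := Finset.one_lt_card.1 (by omega : 1 < (leavesBeyond T r a).card)
  rw [mem_leavesBeyond] at hl hl'
  obtain ⟨z, hz, hmax⟩ := Finset.exists_max_image
    (Finset.univ.filter fun z => OnGeod T r a z ∧ OnGeod T r z l ∧ OnGeod T r z l')
    (fun z => T.dist r z) ⟨a, by simp [onGeod_right, hl.2, hl'.2]⟩
  simp only [Finset.mem_filter, Finset.mem_univ, true_and] at hz hmax
  obtain ⟨h1, h2, h3⟩ := hz
  have hzr : z ≠ r := by
    rintro rfl
    exact ha ((onGeod_self_iff hT).1 h1)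
  have hzl : z ≠ l := by
    rintro rfl
    rcases leaf_mid hT hl.1 h3 with h | h
    · exact hzr h.symm
    · exact hne h.symm
  have hzl' : z ≠ l' := by
    rintro rfl
    rcases leaf_mid hT hl'.1 h2 with h | h
    · exact hzr h.symm
    · exact hne h
  obtain ⟨p, hp, hpr⟩ := exists_next hT hzr
  obtain ⟨c, hc, hcl⟩ := exists_next hT hzl
  obtain ⟨c', hc', hcl'⟩ := exists_next hT hzl'
  have child : ∀ c l, T.Adj z c → OnGeod T r z l → OnGeod T z c l →
      OnGeod T r z c ∧ OnGeod T r c l := by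
    intro c l hc h hcl
    have t1 := hT.connected.dist_triangle (u := r) (v := z) (w := c)
    have t2 := hT.connected.dist_triangle (u := r) (v := c) (w := l)
    unfold OnGeod at *
    omega
  obtain ⟨k1, k2⟩ := child c l hc h2 hcl
  obtain ⟨k1', k2'⟩ := child c' l' hc' h3 hcl'
  have hpc : ∀ c, T.Adj z c → OnGeod T r z c → p ≠ c := by
    rintro c hc h rfl
    exact not_onGeod_both hT hc.ne h hpr
  refine ⟨z, three_le_degree hp hc hc' (hpc c hc k1) (hpc c' hc' k1') ?_, h1⟩
  rintro rfl
  exact hc.ne (k1.eq_of_dist_le hT (hmax c ⟨h1.trans hT k1, k2, k2'⟩))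

open scoped Classical in
lemma sum_card_leavesBeyond (hT : T.IsTree) {r : V} (hr : T.degree r ≠ 1) :
    ∑ c ∈ T.neighborFinset r, (leavesBeyond T r c).card = leafCount T := by
  rw [leafCount, ← Finset.card_biUnion]
  · congr 1
    ext l
    simp only [Finset.mem_biUnion, mem_neighborFinset, mem_leavesBeyond, Finset.mem_filter,
      Finset.mem_univ, true_and]
    constructor
    · rintro ⟨c, -, h, -⟩; exact h
    · intro h
      obtain ⟨c, hc, hcl⟩ := exists_next hT (a := r) (b := l) (by rintro rfl; exact hr h)
      exact ⟨c, hc, h, hcl⟩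
  · intro c hc c' hc' hne
    exact disjoint_leavesBeyond_siblings hT (by simpa using hc) (by simpa using hc')
      (onGeod_left _ _) (onGeod_left _ _) hne

open scoped Classical in
/-- Each neighbour of `r` other than `c` contributes at least one leaf. -/
lemma card_leavesBeyond_add_degree_le (hT : T.IsTree) {r c : V} (hr : T.degree r ≠ 1)
    (hc : T.Adj r c) : (leavesBeyond T r c).card + T.degree r ≤ leafCount T + 1 := by
  have hc' : c ∈ T.neighborFinset r := by simpa
  rw [← sum_card_leavesBeyond hT hr, ← Finset.add_sum_erase _ _ hc']
  have : ((T.neighborFinset r).erase c).card ≤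
      ∑ x ∈ (T.neighborFinset r).erase c, (leavesBeyond T r x).card := by
    rw [Finset.card_eq_sum_ones]
    apply Finset.sum_le_sum
    intro x hx
    simp only [Finset.mem_erase, mem_neighborFinset] at hx
    exact (leavesBeyond_nonempty hT hx.2.ne').card_pos
  rw [Finset.card_erase_of_mem hc', card_neighborFinset_eq_degree] at this
  omega

open scoped Classical in
/-- If one of the other neighbours contributes two leaves, the inequality
`card_leavesBeyond_add_degree_le` is strict. -/
lemma card_leavesBeyond_add_degree_lt (hT : T.IsTree) {r c c' : V} (hr : T.degree r ≠ 1)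
    (hc : T.Adj r c) (hc' : T.Adj r c') (hne : c' ≠ c)
    (h2 : 2 ≤ (leavesBeyond T r c').card) :
    (leavesBeyond T r c).card + T.degree r ≤ leafCount T := by
  have hc1 : c ∈ T.neighborFinset r := by simpa
  have hc2 : c' ∈ (T.neighborFinset r).erase c := by simpa [hne]
  rw [← sum_card_leavesBeyond hT hr, ← Finset.add_sum_erase _ _ hc1]
  have : ((T.neighborFinset r).erase c).card <
      ∑ x ∈ (T.neighborFinset r).erase c, (leavesBeyond T r x).card := by
    rw [Finset.card_eq_sum_ones]
    apply Finset.sum_lt_sum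
    · intro x hx
      simp only [Finset.mem_erase, mem_neighborFinset] at hx
      exact (leavesBeyond_nonempty hT hx.2.ne').card_pos
    · exact ⟨c', hc2, h2⟩
  rw [Finset.card_erase_of_mem hc1, card_neighborFinset_eq_degree] at this
  omega

open scoped Classical in
/-- If every other neighbour contributes at most one leaf, the inequality
`card_leavesBeyond_add_degree_le` is an equality. -/
lemma le_card_leavesBeyond_add_degree (hT : T.IsTree) {r c : V} (hr : T.degree r ≠ 1)
    (hc : T.Adj r c) (h : ∀ c', T.Adj r c' → c' ≠ c → (leavesBeyond T r c').card ≤ 1) :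
    leafCount T + 1 ≤ (leavesBeyond T r c).card + T.degree r := by
  have hc1 : c ∈ T.neighborFinset r := by simpa
  rw [← sum_card_leavesBeyond hT hr, ← Finset.add_sum_erase _ _ hc1]
  have : ∑ x ∈ (T.neighborFinset r).erase c, (leavesBeyond T r x).card ≤
      ((T.neighborFinset r).erase c).card := by
    rw [Finset.card_eq_sum_ones]
    apply Finset.sum_le_sum
    intro x hx
    simp only [Finset.mem_erase, mem_neighborFinset] at hx
    exact h x hx.2 hx.1
  rw [Finset.card_erase_of_mem hc1, card_neighborFinset_eq_degree] at this
  have : 0 < T.degree r := (degree_pos_iff_exists_adj T r).2 ⟨c, hc⟩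
  omega

end Leaves

section Counting

variable {T : SimpleGraph V}

/-- A maximal general position set. -/
def IsMaxGPSet (T : SimpleGraph V) (S : Set V) : Prop :=
  IsGPSet T S ∧ ∀ w, w ∉ S → ¬ IsGPSet T (insert w S)

variable [Fintype V] {M : Finset V} {r x c : V}

lemma onGeod_of_mem_gp (hT : T.IsTree) (hM : IsGPSet T (M : Set V)) (hr : r ∈ M) (hx : x ∈ M)
    (hc : T.Adj r c) (hcx : OnGeod T r c x) {a : V} (ha : a ∈ M) (har : a ≠ r) :
    OnGeod T r c a := by
  rw [isGPSet_iff hT] at hM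
  obtain ⟨c', hc', hca⟩ := exists_next hT har.symm
  by_cases hne : c = c'
  · subst hne; exact hca
  · have hxr : x ≠ r := by
      rintro rfl
      exact hc.ne ((onGeod_self_iff hT).1 hcx).symm
    have hxa : x ≠ a := by
      rintro rfl
      exact hne (next_unique hT hc hc' hcx hca)
    exact absurd (onGeod_of_next_ne hT hc hc' hcx hca hne) (hM x hx r hr a ha hxr har.symm hxa)

open scoped Classical in
lemma sum_card_leavesBeyond_le (hT : T.IsTree) (hM : IsGPSet T (M : Set V)) (hr : r ∈ M)
    (hx : x ∈ M) (hc : T.Adj r c) (hcx : OnGeod T r c x) :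
    ∑ a ∈ M.erase r, (leavesBeyond T r a).card ≤ (leavesBeyond T r c).card := by
  rw [← Finset.card_biUnion]
  · apply Finset.card_le_card
    rw [Finset.biUnion_subset]
    intro a ha
    rw [Finset.mem_erase] at ha
    exact leavesBeyond_mono hT (onGeod_of_mem_gp hT hM hr hx hc hcx ha.2 ha.1)
  · intro a ha b hb hab
    simp only [Finset.coe_erase, Set.mem_sdiff, Finset.mem_coe, Set.mem_singleton_iff] at ha hb
    rw [isGPSet_iff hT] at hM
    exact disjoint_leavesBeyond hT (hM r hr a ha.1 b hb.1 (Ne.symm ha.2) hab (Ne.symm hb.2))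
      (hM r hr b hb.1 a ha.1 (Ne.symm hb.2) hab.symm (Ne.symm ha.2))

lemma card_gp_le (hT : T.IsTree) (hM : IsGPSet T (M : Set V)) (hr : r ∈ M)
    (hx : x ∈ M) (hc : T.Adj r c) (hcx : OnGeod T r c x) :
    M.card ≤ (leavesBeyond T r c).card + 1 := by
  classical
  have h1 := sum_card_leavesBeyond_le hT hM hr hx hc hcx
  have h2 : (M.erase r).card ≤ ∑ a ∈ M.erase r, (leavesBeyond T r a).card := by
    rw [Finset.card_eq_sum_ones]
    exact Finset.sum_le_sum fun a ha =>
      (leavesBeyond_nonempty hT (Finset.mem_erase.1 ha).1).card_pos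
  rw [Finset.card_erase_of_mem hr] at h2
  omega

lemma card_gp_le_of_two_le (hT : T.IsTree) (hM : IsGPSet T (M : Set V)) (hr : r ∈ M)
    (hx : x ∈ M) (hc : T.Adj r c) (hcx : OnGeod T r c x) {a : V} (ha : a ∈ M) (har : a ≠ r)
    (h : 2 ≤ (leavesBeyond T r a).card) : M.card ≤ (leavesBeyond T r c).card := by
  classical
  have h1 := sum_card_leavesBeyond_le hT hM hr hx hc hcx
  have h2 : (M.erase r).card < ∑ a ∈ M.erase r, (leavesBeyond T r a).card := by
    rw [Finset.card_eq_sum_ones]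
    exact Finset.sum_lt_sum (fun a ha =>
      (leavesBeyond_nonempty hT (Finset.mem_erase.1 ha).1).card_pos)
      ⟨a, Finset.mem_erase.2 ⟨har, ha⟩, h⟩
  rw [Finset.card_erase_of_mem hr] at h2
  omega

/-- In a maximal general position set containing `r`, every leaf on the played side of `r` is
beyond some selected vertex. -/
lemma exists_mem_onGeod_leaf (hT : T.IsTree) (hM : IsMaxGPSet T (M : Set V)) (hr : r ∈ M)
    (hx : x ∈ M) (hc : T.Adj r c) (hcx : OnGeod T r c x) {l : V} (hl : l ∈ leavesBeyond T r c) :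
    ∃ a ∈ M, a ≠ r ∧ OnGeod T r a l := by
  classical
  by_contra! hcon
  obtain ⟨hgp, hmax⟩ := hM
  rw [mem_leavesBeyond] at hl
  have hlr : l ≠ r := by
    rintro rfl
    exact hc.ne ((onGeod_self_iff hT).1 hl.2).symm
  have hlM : l ∉ M := fun h => hcon l h hlr (onGeod_right _ _)
  have hcomp := fun a ha har => onGeod_of_mem_gp (a := a) hT hgp hr hx hc hcx ha har
  have hgp' := (isGPSet_iff hT _).1 hgp
  have key : ∀ a ∈ M, ∀ b ∈ M, a ≠ b → ¬ OnGeod T a b l := by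
    intro a ha b hb hab h
    by_cases hbr : b = r
    · subst hbr
      have h1 := hcomp a ha hab
      have h2 := dist_of_next hc h1
      have h3 := dist_of_next hc hl.2
      have h4 := hT.connected.dist_triangle (u := a) (v := c) (w := l)
      unfold OnGeod at h
      rw [T.dist_comm (u := c) (v := l)] at h4
      rw [T.dist_comm (u := b) (v := l)] at h
      omega
    · rcases onGeod_split hT h r with h1 | h1
      · by_cases har : a = r
        · subst har
          exact hcon b hb hbr h
        · exact hgp' r hr b hb a ha (Ne.symm hbr) hab.symm (Ne.symm har) h1
      · exact hcon b hb hbr h1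
  apply hmax l (by simpa using hlM)
  rw [isGPSet_iff hT]
  rintro a (rfl | ha) b hb d (rfl | hd) hab hbd had h
  · exact had rfl
  · rcases hb with rfl | hb
    · exact hab rfl
    · exact key d hd b hb hbd.symm h.symm
  · rcases hb with rfl | hb
    · exact hbd rfl
    · exact key a ha b hb hab h
  · rcases hb with rfl | hb
    · rcases leaf_mid hT hl.1 h with h | h
      · exact hab h
      · exact hbd h.symm
    · exact hgp' a ha b hb d hd hab hbd had h

lemma card_leavesBeyond_le_card_maxGP (hT : T.IsTree) (hM : IsMaxGPSet T (M : Set V))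
    (hr : r ∈ M) (hx : x ∈ M) (hc : T.Adj r c) (hcx : OnGeod T r c x)
    (h1 : ∀ a ∈ M, a ≠ r → (leavesBeyond T r a).card ≤ 1) :
    (leavesBeyond T r c).card + 1 ≤ M.card := by
  classical
  have h2 : leavesBeyond T r c ⊆ (M.erase r).biUnion fun a => leavesBeyond T r a := by
    intro l hl
    obtain ⟨a, ha, har, hal⟩ := exists_mem_onGeod_leaf hT hM hr hx hc hcx hl
    exact Finset.mem_biUnion.2 ⟨a, Finset.mem_erase.2 ⟨har, ha⟩,
      mem_leavesBeyond.2 ⟨(mem_leavesBeyond.1 hl).1, hal⟩⟩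
  have h3 := (Finset.card_le_card h2).trans (Finset.card_biUnion_le_card_mul _ _ 1 (by
    intro a ha
    rw [Finset.mem_erase] at ha
    exact h1 a ha.2 ha.1))
  rw [Finset.card_erase_of_mem hr] at h3
  have := Finset.card_pos.2 ⟨r, hr⟩
  omega

end Counting

section Game

variable [Fintype V] {T : SimpleGraph V}

open scoped Classical in
lemma mem_playable {S : Finset V} {v : V} :
    v ∈ playable T S ↔ v ∉ S ∧ IsGPSet T (↑(insert v S) : Set V) := by
  simp [playable]

open scoped Classical in
lemma exists_maxGP_card_eq (n : ℕ) (turn : Bool) (S : Finset V) (hS : IsGPSet T (S : Set V))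
    (hn : Fintype.card V ≤ n + S.card) :
    ∃ M : Finset V, S ⊆ M ∧ IsMaxGPSet T (M : Set V) ∧ M.card = gameValAux T n turn S := by
  induction n generalizing turn S with
  | zero =>
    refine ⟨S, subset_rfl, ⟨hS, fun w hw => ?_⟩, rfl⟩
    have : S = Finset.univ := Finset.eq_univ_of_card S (le_antisymm (Finset.card_le_univ S)
      (by omega))
    simp [this] at hw
  | succ n ih =>
    by_cases h : (playable T S).Nonempty
    · have step : ∀ v ∈ playable T S, ∃ M : Finset V, S ⊆ M ∧ IsMaxGPSet T (M : Set V) ∧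
          M.card = gameValAux T n (!turn) (insert v S) := by
        intro v hv
        rw [mem_playable] at hv
        obtain ⟨M, h1, h2, h3⟩ := ih (!turn) (insert v S) hv.2 (by
          rw [Finset.card_insert_of_notMem hv.1]; omega)
        exact ⟨M, (Finset.subset_insert _ _).trans h1, h2, h3⟩
      simp only [gameValAux, dif_pos h]
      split_ifs
      · obtain ⟨v, hv, hv'⟩ := Finset.exists_mem_eq_sup' h
          (fun v => gameValAux T n (!turn) (insert v S))
        rw [hv']
        exact step v hv
      · obtain ⟨v, hv, hv'⟩ := Finset.exists_mem_eq_inf' h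
          (fun v => gameValAux T n (!turn) (insert v S))
        rw [hv']
        exact step v hv
    · refine ⟨S, subset_rfl, ⟨hS, fun w hw hw' => h ⟨w, ?_⟩⟩, ?_⟩
      · rw [mem_playable]
        exact ⟨hw, by push_cast; exact hw'⟩
      · simp [gameValAux, dif_neg h]

lemma isGPSet_of_ncard_le (S : Set V) (hS : S.ncard ≤ 2) : IsGPSet T S := fun _ _ _ _ _ =>
  (Set.ncard_le_ncard Set.inter_subset_left (Set.toFinite _)).trans hS

lemma isGPSet_pair (v x : V) : IsGPSet T ({v, x} : Set V) :=
  isGPSet_of_ncard_le _ ((Set.ncard_insert_le v {x}).trans (by simp))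

open scoped Classical in
/-- Builder's guarantee: a reply `x` to every first move `v` such that all maximal general
position sets through `v` and `x` are large. -/
lemma le_gpg' (h3 : 3 ≤ Fintype.card V) {N : ℕ}
    (h : ∀ v : V, ∃ x, x ≠ v ∧ ∀ M : Finset V, IsMaxGPSet T (M : Set V) → v ∈ M → x ∈ M →
      N ≤ M.card) : N ≤ gpg' T := by
  obtain ⟨n, hn⟩ : ∃ n, Fintype.card V = n + 2 := ⟨Fintype.card V - 2, by omega⟩
  have hne : (playable T ∅).Nonempty := by
    obtain ⟨v⟩ : Nonempty V := Fintype.card_pos_iff.1 (by omega)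
    exact ⟨v, mem_playable.2 ⟨by simp, by
      simpa using isGPSet_of_ncard_le (T := T) ({v} : Set V) (by simp)⟩⟩
  simp only [gpg', gameVal, Finset.card_empty, Nat.sub_zero, hn]
  rw [gameValAux, dif_pos hne, if_neg (by simp), Finset.le_inf'_iff]
  intro v hv
  obtain ⟨x, hxv, hx⟩ := h v
  have hxp : x ∈ playable T (insert v ∅) := mem_playable.2 ⟨by simpa, by
    simpa using isGPSet_pair x v⟩
  rw [gameValAux, dif_pos (show (playable T _).Nonempty from ⟨x, hxp⟩), if_pos (by simp)]
  refine le_trans ?_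
    (Finset.le_sup' (fun w => gameValAux T n (!!false) (insert w (insert v ∅))) hxp)
  obtain ⟨M, hM1, hM2, hM3⟩ := exists_maxGP_card_eq (T := T) n (!!false) (insert x (insert v ∅))
    (by simpa using isGPSet_pair x v) (by
      rw [Finset.card_insert_of_notMem (by simpa)]; simp [hn])
  rw [← hM3]
  exact hx M hM2 (hM1 (by simp)) (hM1 (by simp))

open scoped Classical in
/-- Blocker's guarantee. If the value is at least `N`, then for every first move `v` there is a
reply `x` such that, whatever Blocker plays next, large general position sets remain. -/
lemma exists_reply_of_le_gpg' (h3 : 3 ≤ Fintype.card V) {N : ℕ} (hN : N ≤ gpg' T) (v : V) :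
    ∃ x, x ≠ v ∧ (∃ M : Finset V, IsGPSet T (M : Set V) ∧ v ∈ M ∧ x ∈ M ∧ N ≤ M.card) ∧
      ∀ y, y ≠ v → y ≠ x → IsGPSet T ({y, x, v} : Set V) →
        ∃ M : Finset V, IsGPSet T (M : Set V) ∧ v ∈ M ∧ x ∈ M ∧ y ∈ M ∧ N ≤ M.card := by
  obtain ⟨n, hn⟩ : ∃ n, Fintype.card V = n + 3 := ⟨Fintype.card V - 3, by omega⟩
  have hvp : v ∈ playable T ∅ := mem_playable.2 ⟨by simp, by
    simpa using isGPSet_of_ncard_le (T := T) ({v} : Set V) (by simp)⟩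
  simp only [gpg', gameVal, Finset.card_empty, Nat.sub_zero, hn] at hN
  rw [gameValAux, dif_pos (show (playable T ∅).Nonempty from ⟨v, hvp⟩), if_neg (by simp),
      Finset.le_inf'_iff] at hN
  replace hN := hN v hvp
  have hne : (playable T (insert v ∅)).Nonempty := by
    have : Nontrivial V := Fintype.one_lt_card_iff_nontrivial.1 (by omega)
    obtain ⟨x, hx⟩ := exists_ne v
    exact ⟨x, mem_playable.2 ⟨by simpa, by simpa using isGPSet_pair x v⟩⟩
  rw [gameValAux, dif_pos hne, if_pos (by simp), Finset.le_sup'_iff] at hN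
  obtain ⟨x, hx, hN⟩ := hN
  have hxv : x ≠ v := by simpa using (mem_playable.1 hx).1
  refine ⟨x, hxv, ?_, ?_⟩
  · obtain ⟨M, hM1, hM2, hM3⟩ := exists_maxGP_card_eq (T := T) (n + 1) (!!false)
      (insert x (insert v ∅)) (by simpa using isGPSet_pair x v) (by
        rw [Finset.card_insert_of_notMem (by simpa)]; simp [hn])
    exact ⟨M, hM2.1, hM1 (by simp), hM1 (by simp), by rw [hM3]; exact hN⟩
  · intro y hyv hyx hgp
    have hyp : y ∈ playable T (insert x (insert v ∅)) := mem_playable.2 ⟨by simp [hyv, hyx], by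
      simpa using hgp⟩
    rw [gameValAux, dif_pos (show (playable T _).Nonempty from ⟨y, hyp⟩), if_neg (by simp),
      Finset.le_inf'_iff] at hN
    replace hN := hN y hyp
    obtain ⟨M, hM1, hM2, hM3⟩ := exists_maxGP_card_eq (T := T) n (!!!false)
      (insert y (insert x (insert v ∅))) (by simpa using hgp) (by
        rw [Finset.card_insert_of_notMem (by simp [hyv, hyx]),
          Finset.card_insert_of_notMem (by simpa)]
        simp [hn])
    exact ⟨M, hM2.1, hM1 (by simp), hM1 (by simp), hM1 (by simp), by rw [hM3]; exact hN⟩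

end Game

section Characterization

variable {T : SimpleGraph V}

lemma not_onGeod_of_next (hT : T.IsTree) {b v x c : V} (hc : T.Adj v c) (hb : OnGeod T v c b)
    (hx : OnGeod T v c x) : ¬ OnGeod T b v x := by
  intro h
  have h1 := dist_of_next hc hb
  have h2 := dist_of_next hc hx
  have h3 := hT.connected.dist_triangle (u := b) (v := c) (w := x)
  unfold OnGeod at h
  rw [T.dist_comm (u := c) (v := x)] at h3
  rw [T.dist_comm (u := v) (v := x)] at h
  omega

lemma onGeod_next_of_onGeod (hT : T.IsTree) {r z c l : V} (hc : T.Adj z c) (h : OnGeod T r z l)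
    (hcl : OnGeod T z c l) : OnGeod T r z c ∧ OnGeod T r c l := by
  have h0 : T.dist z c = 1 := dist_eq_one_iff_adj.2 hc
  have t1 := hT.connected.dist_triangle (u := r) (v := z) (w := c)
  have t2 := hT.connected.dist_triangle (u := r) (v := c) (w := l)
  unfold OnGeod at *
  omega

lemma onGeod_of_child (hT : T.IsTree) {r z c l : V} (hc : T.Adj z c) (h : OnGeod T r z c)
    (hcl : OnGeod T z c l) : OnGeod T r z l := by
  have h0 : T.dist z c = 1 := dist_eq_one_iff_adj.2 hc
  refine onGeod_of_steps hT hc ?_ hcl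
  unfold OnGeod at h
  omega

variable [Fintype V]

open scoped Classical in
lemma exists_degree_eq_maxDeg (hT : T.IsTree) (h3 : 3 ≤ Fintype.card V) :
    ∃ v, T.degree v = maxDeg T ∧ 2 ≤ T.degree v := by
  have hne : (Finset.univ : Finset V).Nonempty := Finset.card_pos.1 (by simp; omega)
  obtain ⟨v, -, hv⟩ := Finset.exists_mem_eq_sup Finset.univ hne fun v => T.degree v
  refine ⟨v, hv.symm, ?_⟩
  by_contra hcon
  have h1 : ∑ w, T.degree w ≤ ∑ _w : V, 1 := Finset.sum_le_sum fun w hw => by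
    have := Finset.le_sup (f := fun v => T.degree v) hw
    rw [hv] at this
    omega
  have h2 := T.sum_degrees_eq_twice_card_edges
  have h4 := hT.card_edgeFinset
  simp at h1
  omega

open scoped Classical in
lemma degree_le_leafCount (hT : T.IsTree) {v : V} (hv : 2 ≤ T.degree v) :
    T.degree v ≤ leafCount T := by
  obtain ⟨c, hc⟩ := (degree_pos_iff_exists_adj T v).1 (by omega)
  have h1 := card_leavesBeyond_add_degree_le hT (by omega) hc
  have h2 := (leavesBeyond_nonempty hT (r := v) hc.ne').card_pos
  omega

open scoped Classical in
lemma gpg'_le (hT : T.IsTree) (h3 : 3 ≤ Fintype.card V) :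
    gpg' T ≤ leafCount T - maxDeg T + 2 := by
  obtain ⟨v, hv, hv2⟩ := exists_degree_eq_maxDeg hT h3
  obtain ⟨x, hxv, ⟨M, hM, hvM, hxM, hN⟩, -⟩ := exists_reply_of_le_gpg' h3 le_rfl v
  obtain ⟨c, hc, hcx⟩ := exists_next hT hxv.symm
  have h1 := card_gp_le hT hM hvM hxM hc hcx
  have h2 := card_leavesBeyond_add_degree_le hT (by omega) hc
  omega

lemma isGPSet_triple (hT : T.IsTree) {b x v : V} (h1 : ¬ OnGeod T v b x)
    (h2 : ¬ OnGeod T v x b) (h3 : ¬ OnGeod T b v x) : IsGPSet T ({b, x, v} : Set V) := by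
  rw [isGPSet_iff hT]
  rintro p (rfl | rfl | rfl) q (rfl | rfl | rfl) r (rfl | rfl | rfl) hpq hqr hpr h
  all_goals first
    | exact hpq rfl
    | exact hqr rfl
    | exact hpr rfl
    | exact h1 h
    | exact h2 h
    | exact h3 h
    | exact h1 h.symm
    | exact h2 h.symm
    | exact h3 h.symm

open scoped Classical in
lemma exists_branch_path_of_le_gpg' (hT : T.IsTree) (h3 : 3 ≤ Fintype.card V)
    (hN : leafCount T - maxDeg T + 2 ≤ gpg' T) :
    ∃ v x, 2 ≤ T.degree v ∧ x ≠ v ∧ T.degree x = 1 ∧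
      (∀ b, 3 ≤ T.degree b → OnGeod T v b x) ∧ leafCount T + 2 ≤ 2 * T.degree v := by
  obtain ⟨v, hv, hv2⟩ := exists_degree_eq_maxDeg hT h3
  have hle := degree_le_leafCount hT hv2
  rw [← hv] at hN
  obtain ⟨x, hxv, ⟨M, hM, hvM, hxM, hMN⟩, hy⟩ := exists_reply_of_le_gpg' h3 hN v
  obtain ⟨c, hc, hcx⟩ := exists_next hT hxv.symm
  have h1 := card_gp_le hT hM hvM hxM hc hcx
  have h2 := card_leavesBeyond_add_degree_le hT (by omega) hc
  have hx1 : (leavesBeyond T v x).card ≤ 1 := by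
    by_contra hcon
    have := card_gp_le_of_two_le hT hM hvM hxM hc hcx hxM hxv (by omega)
    omega
  have hbranch : ∀ b, 3 ≤ T.degree b → OnGeod T v b x := by
    intro b hb
    have hb2 := two_le_card_leavesBeyond hT (r := v) hb
    by_contra hbx
    have hbv : b ≠ v := by rintro rfl; exact hbx (onGeod_left _ _)
    have hbx' : b ≠ x := by rintro rfl; exact hbx (onGeod_right _ _)
    have hxb : ¬ OnGeod T v x b := fun h => by
      have := Finset.card_le_card (leavesBeyond_mono hT h)
      omega
    have hvb : ¬ OnGeod T b v x := fun h => by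
      obtain ⟨c', hc', hcb⟩ := exists_next hT hbv.symm
      have hne : c' ≠ c := by
        rintro rfl
        exact not_onGeod_of_next hT hc hcb hcx h
      have h4 := card_leavesBeyond_add_degree_lt hT (by omega) hc hc' hne
        (hb2.trans (Finset.card_le_card (leavesBeyond_mono hT hcb)))
      omega
    obtain ⟨M', hM', hvM', hxM', hbM', hMN'⟩ := hy b hbv hbx' (isGPSet_triple hT hbx hxb hvb)
    have := card_gp_le_of_two_le hT hM' hvM' hxM' hc hcx hbM' hbv hb2
    omega
  have hcount : leafCount T + 2 ≤ 2 * T.degree v := by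
    by_contra hcon
    obtain ⟨u, hu, hmax⟩ := Finset.exists_max_image (Finset.univ.filter fun u => OnGeod T v c u ∧
      OnGeod T v u x ∧ (leavesBeyond T v u).card = (leavesBeyond T v c).card)
      (fun u => T.dist v u) ⟨c, by simp [onGeod_right, hcx]⟩
    simp only [Finset.mem_filter, Finset.mem_univ, true_and] at hu hmax
    obtain ⟨hcu, hux, hDu⟩ := hu
    have hux' : u ≠ x := by rintro rfl; omega
    obtain ⟨x', hx', ⟨M', hM', huM', hxM', hMN'⟩, -⟩ := exists_reply_of_le_gpg' h3 hN u
    obtain ⟨c', hc', hcx'⟩ := exists_next hT hx'.symm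
    have h4 := card_gp_le hT hM' huM' hxM' hc' hcx'
    rcases onGeod_or_of_adj hT v hc' with h | h
    · have h5 : (leavesBeyond T u c').card ≤ (leavesBeyond T v c').card := by
        apply Finset.card_le_card
        intro l hl
        rw [mem_leavesBeyond] at *
        exact ⟨hl.1, (onGeod_next_of_onGeod hT hc' (onGeod_of_child hT hc' h hl.2) hl.2).2⟩
      obtain ⟨e, he, hex⟩ := exists_next hT hux'
      obtain ⟨hue, hex'⟩ := onGeod_next_of_onGeod hT he hux hex
      have h6 : (leavesBeyond T v c').card < (leavesBeyond T v u).card := by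
        by_cases hce : c' = e
        · subst hce
          apply lt_of_le_of_ne (Finset.card_le_card (leavesBeyond_mono hT h))
          intro heq
          exact hc'.ne (h.eq_of_dist_le hT (hmax c' ⟨hcu.trans hT h, hex', heq.trans hDu⟩))
        · have h7 := Finset.card_union_of_disjoint
            (disjoint_leavesBeyond_siblings hT hc' he h hue hce)
          have h8 := Finset.card_le_card (Finset.union_subset (leavesBeyond_mono hT h)
            (leavesBeyond_mono hT hue))
          have h9 := (leavesBeyond_nonempty hT (ne_of_child hT he hue)).card_pos
          omega
      omega
    · have hdisj : Disjoint (leavesBeyond T u c') (leavesBeyond T v u) := by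
        rw [Finset.disjoint_left]
        intro l hl hl'
        rw [mem_leavesBeyond] at *
        exact not_onGeod_of_next hT hc' h hl.2 hl'.2
      have h5 := Finset.card_union_of_disjoint hdisj
      have h6 : (leavesBeyond T u c' ∪ leavesBeyond T v u).card ≤ leafCount T := by
        apply Finset.card_le_card
        intro l hl
        rw [Finset.mem_union, mem_leavesBeyond, mem_leavesBeyond] at hl
        simp only [Finset.mem_filter, Finset.mem_univ, true_and]
        exact hl.elim (·.1) (·.1)
      omega
  obtain ⟨l, hl⟩ := leavesBeyond_nonempty hT hxv
  rw [mem_leavesBeyond] at hl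
  exact ⟨v, l, hv2, by rintro rfl; exact hxv ((onGeod_self_iff hT).1 hl.2), hl.1,
    fun b hb => (hbranch b hb).trans hT hl.2, hcount⟩

open scoped Classical in
lemma le_gpg'_of_branch_path (hT : T.IsTree) (h3 : 3 ≤ Fintype.card V) {v₀ : V}
    (h : ∃ x, ∀ b, 3 ≤ T.degree b → OnGeod T v₀ b x)
    (hdeg : leafCount T + 2 ≤ 2 * T.degree v₀) : leafCount T - T.degree v₀ + 2 ≤ gpg' T := by
  obtain ⟨x₀, hx₀, hxl, hbr⟩ : ∃ x, x ≠ v₀ ∧ T.degree x = 1 ∧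
      ∀ b, 3 ≤ T.degree b → OnGeod T v₀ b x := by
    obtain ⟨x, hx⟩ := h
    obtain ⟨y, hy, hxy⟩ : ∃ y, y ≠ v₀ ∧ OnGeod T v₀ x y := by
      by_cases hxv : x = v₀
      · have : Nontrivial V := Fintype.one_lt_card_iff_nontrivial.1 (by omega)
        obtain ⟨y, hy⟩ := exists_ne v₀
        exact ⟨y, hy, by subst hxv; exact onGeod_left _ _⟩
      · exact ⟨x, hxv, onGeod_right _ _⟩
    obtain ⟨l, hl⟩ := leavesBeyond_nonempty hT hy
    rw [mem_leavesBeyond] at hl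
    exact ⟨l, by rintro rfl; exact hy ((onGeod_self_iff hT).1 hl.2), hl.1,
      fun b hb => ((hx b hb).trans hT hxy).trans hT hl.2⟩
  have hl1 : 1 ≤ leafCount T := Finset.card_pos.2 ⟨x₀, by simpa⟩
  apply le_gpg' h3
  intro v
  by_cases hv : v = v₀
  · subst hv
    refine ⟨x₀, hx₀, fun M hM hvM hxM => ?_⟩
    obtain ⟨c, hc, hcx⟩ := exists_next hT hx₀.symm
    have h1 := le_card_leavesBeyond_add_degree hT (by omega) hc (by
      intro c' hc' hne
      by_contra hcon
      obtain ⟨b, hb, hcb⟩ := exists_branch hT hc'.ne' (by omega : 2 ≤ (leavesBeyond T v c').card)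
      exact hne (next_unique hT hc' hc (hcb.trans hT (hbr b hb)) hcx))
    have h2 := card_leavesBeyond_le_card_maxGP hT hM hvM hxM hc hcx (by
      intro a ha hav
      by_contra hcon
      obtain ⟨b, hb, hab⟩ := exists_branch hT hav (by omega : 2 ≤ (leavesBeyond T v a).card)
      by_cases hax : a = x₀
      · subst hax
        obtain rfl := hab.antisymm hT (hbr b hb)
        omega
      · exact (isGPSet_iff hT _).1 hM.1 v hvM a ha x₀ hxM hav.symm hax hx₀.symm
          (hab.trans hT (hbr b hb)))
    have h4 := (leavesBeyond_nonempty hT (r := v) hc.ne').card_pos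
    omega
  · obtain ⟨p, hp, hpv⟩ := exists_next hT (Ne.symm hv)
    have leaf : ∀ q : V, ∃ l, T.Adj v₀ q → T.degree l = 1 ∧ OnGeod T v₀ q l := by
      intro q
      by_cases hq : T.Adj v₀ q
      · obtain ⟨l, hl⟩ := leavesBeyond_nonempty hT (r := v₀) hq.ne'
        exact ⟨l, fun _ => mem_leavesBeyond.1 hl⟩
      · exact ⟨q, fun h => absurd h hq⟩
    choose l hl using leaf
    have hvl : ∀ q, T.Adj v₀ q → q ≠ p → OnGeod T v v₀ (l q) := fun q hq hne =>
      onGeod_of_next_ne hT hp hq hpv (hl q hq).2 hne.symm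
    have hcard : ((T.neighborFinset v₀).erase p).card = T.degree v₀ - 1 := by
      rw [Finset.card_erase_of_mem (by simpa), card_neighborFinset_eq_degree]
    obtain ⟨q₀, hq₀⟩ := Finset.card_pos.1 (by omega : 0 < ((T.neighborFinset v₀).erase p).card)
    simp only [Finset.mem_erase, mem_neighborFinset] at hq₀
    have hx := hvl q₀ hq₀.2 hq₀.1
    have hxv : l q₀ ≠ v := by
      intro heq
      rw [heq] at hx
      exact hv ((onGeod_self_iff hT).1 hx).symm
    have hxv₀ : l q₀ ≠ v₀ := by
      intro heq
      have := (hl q₀ hq₀.2).2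
      rw [heq] at this
      exact hq₀.2.ne' ((onGeod_self_iff hT).1 this)
    refine ⟨l q₀, hxv, fun M hM hvM hxM => ?_⟩
    obtain ⟨c, hc, hcv⟩ := exists_next hT hv
    have cover : ∀ q, ∃ a, T.Adj v₀ q → q ≠ p → a ∈ M ∧ a ≠ v ∧ OnGeod T v a (l q) := by
      intro q
      by_cases hq : T.Adj v₀ q ∧ q ≠ p
      · obtain ⟨a, h1, h2, h4⟩ := exists_mem_onGeod_leaf hT hM hvM hxM hc (hcv.trans hT hx)
          (mem_leavesBeyond.2 ⟨(hl q hq.1).1, hcv.trans hT (hvl q hq.1 hq.2)⟩)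
        exact ⟨a, fun _ _ => ⟨h1, h2, h4⟩⟩
      · exact ⟨q, fun h h' => absurd ⟨h, h'⟩ hq⟩
    choose a ha using cover
    have hinj := Finset.card_le_card_of_injOn (s := (T.neighborFinset v₀).erase p)
      (t := M.erase v) a (by
        intro q hq
        simp only [Finset.coe_erase, Set.mem_sdiff, Finset.mem_coe, mem_neighborFinset,
          Set.mem_singleton_iff] at hq ⊢
        obtain ⟨h1, h2, -⟩ := ha q hq.1 hq.2
        exact ⟨h1, h2⟩) (by
      intro q hq q' hq' heq
      simp only [Finset.coe_erase, Set.mem_sdiff, Finset.mem_coe, mem_neighborFinset,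
          Set.mem_singleton_iff] at hq hq'
      obtain ⟨h1, h2, h4⟩ := ha q hq.1 hq.2
      obtain ⟨-, -, h4'⟩ := ha q' hq'.1 hq'.2
      rw [← heq] at h4'
      have habove : ¬ OnGeod T v (a q) v₀ := by
        intro hab
        have hax := hab.trans hT hx
        by_cases hne : a q = l q₀
        · rw [hne] at hab
          exact hxv₀ (hab.antisymm hT hx)
        · exact (isGPSet_iff hT _).1 hM.1 v hvM (a q) h1 (l q₀) hxM h2.symm hne hxv.symm hax
      have hbelow : OnGeod T v v₀ (a q) :=
        (onGeod_total hT h4 (hvl q hq.1 hq.2)).resolve_left habove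
      have hne : v₀ ≠ a q := by
        intro hne
        rw [← hne] at habove
        exact habove (onGeod_right _ _)
      obtain ⟨e, he, hea⟩ := exists_next hT hne
      have e1 := next_unique hT he hq.1 (hea.trans hT (hbelow.trans_right hT h4)) (hl q hq.1).2
      have e2 := next_unique hT he hq'.1 (hea.trans hT (hbelow.trans_right hT h4')) (hl q' hq'.1).2
      exact e1.symm.trans e2)
    rw [hcard, Finset.card_erase_of_mem hvM] at hinj
    have := Finset.card_pos.2 ⟨v, hvM⟩
    omega

end Characterization

section Covering

variable {T : SimpleGraph V}

lemma onGeod_of_nonbacktracking (hT : T.IsTree) (p : ℕ → V) (n : ℕ)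
    (h1 : ∀ i, i < n → T.Adj (p i) (p (i + 1)))
    (h2 : ∀ i, i + 2 ≤ n → p i ≠ p (i + 2)) {i : ℕ} (hi : i ≤ n) : OnGeod T (p 0) (p i) (p n) := by
  have e1 := dist_of_nonbacktracking hT p n h1 h2 i hi
  have e2 := dist_of_nonbacktracking hT p n h1 h2 n le_rfl
  have e3 := dist_of_nonbacktracking hT (fun k => p (i + k)) (n - i)
    (fun k hk => h1 (i + k) (by omega)) (fun k hk => h2 (i + k) (by omega)) (n - i) le_rfl
  simp only [Nat.add_zero, Nat.add_sub_cancel' hi] at e3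
  unfold OnGeod
  omega

/-- A map from a connected graph onto a tree that is bijective on neighbourhoods is an
isomorphism. -/
lemma nonempty_iso_of_covering {W : Type*} {G : SimpleGraph W} (hT : T.IsTree)
    (hG : G.Connected) (f : W → V) (hom : ∀ a b, G.Adj a b → T.Adj (f a) (f b))
    (inj : ∀ a b c, G.Adj a b → G.Adj a c → f b = f c → b = c)
    (surj : ∀ a z, T.Adj (f a) z → ∃ b, G.Adj a b ∧ f b = z) : Nonempty (T ≃g G) := by
  have hinj : Function.Injective f := by
    intro a b hab
    obtain ⟨p, hp, -⟩ := hG.exists_path_of_dist a b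
    have := dist_of_nonbacktracking hT (fun i => f (p.getVert i)) p.length
      (fun i hi => hom _ _ (p.adj_getVert_succ hi))
      (fun i hi heq => by
        have h1 := inj (p.getVert (i + 1)) _ _ (p.adj_getVert_succ (by omega)).symm
          (p.adj_getVert_succ (i := i + 1) (by omega)) heq
        have := hp.getVert_injOn (by simp; omega) (by simp; omega) h1
        omega) p.length le_rfl
    simp only [Walk.getVert_zero, Walk.getVert_length, hab, dist_self] at this
    exact Walk.eq_of_length_eq_zero this.symm
  have hsurj : Function.Surjective f := by
    obtain ⟨a⟩ := hG.nonempty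
    intro z
    have key : ∀ n z, T.dist (f a) z = n → ∃ b, f b = z := by
      intro n
      induction n with
      | zero => intro z hz; exact ⟨a, hT.connected.dist_eq_zero_iff.1 hz⟩
      | succ n ih =>
        intro z hz
        obtain ⟨c, hc, hd⟩ := exists_parent hT (r := f a) (a := z) (by
          rintro rfl; simp at hz)
        obtain ⟨b, rfl⟩ := ih c (by omega)
        obtain ⟨b', -, hb'⟩ := surj b z hc.symm
        exact ⟨b', hb'⟩
    exact key _ z rfl
  refine ⟨RelIso.symm ⟨Equiv.ofBijective f ⟨hinj, hsurj⟩, ?_⟩⟩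
  intro a b
  constructor
  · intro h
    obtain ⟨b', hb', heq⟩ := surj a (f b) h
    rwa [← hinj heq]
  · exact hom a b

end Covering

section Model

variable {K : ℕ} {s : Fin K → ℕ} {L : (i : Fin K) → Fin (s i) → ℕ}

/-- The neighbour of a leg vertex in the direction of the central path. -/
def legPred (L : (i : Fin K) → Fin (s i) → ℕ) (i : Fin K) (j : Fin (s i)) (a : Fin (L i j)) :
    Fin K ⊕ Σ i : Fin K, Σ j : Fin (s i), Fin (L i j) :=
  if (a : ℕ) = 0 then Sum.inl i else Sum.inr ⟨i, j, ⟨a - 1, by omega⟩⟩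

lemma genModel_adj_inl_inl {i i' : Fin K} : (GenModel K s L).Adj (Sum.inl i) (Sum.inl i') ↔
    (i' : ℕ) = i + 1 ∨ (i : ℕ) = i' + 1 := by
  simp only [GenModel, fromRel_adj, GenModelRel, ne_eq, Sum.inl.injEq, Fin.ext_iff]
  omega

lemma genModel_adj_inl_inr {i i' : Fin K} {j : Fin (s i')} {a : Fin (L i' j)} :
    (GenModel K s L).Adj (Sum.inl i) (Sum.inr ⟨i', j, a⟩) ↔ i = i' ∧ (a : ℕ) = 0 := by
  simp [GenModel, fromRel_adj, GenModelRel]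

lemma genModel_adj_inr_inr {i : Fin K} {j : Fin (s i)} {a : Fin (L i j)} {i' : Fin K}
    {j' : Fin (s i')} {a' : Fin (L i' j')} :
    (GenModel K s L).Adj (Sum.inr ⟨i, j, a⟩) (Sum.inr ⟨i', j', a'⟩) ↔
      (i : ℕ) = i' ∧ (j : ℕ) = j' ∧ ((a' : ℕ) = a + 1 ∨ (a : ℕ) = a' + 1) := by
  simp only [GenModel, fromRel_adj, GenModelRel]
  constructor
  · rintro ⟨-, h | h⟩ <;> omega
  · rintro ⟨h1, h2, h3⟩
    refine ⟨?_, by omega⟩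
    intro h
    have h1 := Fin.ext h1
    subst h1
    have h2 := Fin.ext h2
    subst h2
    simp only [Sum.inr.injEq, Sigma.mk.injEq, heq_eq_eq, true_and] at h
    subst h
    omega

lemma genModel_adj_inl_iff {i : Fin K} {w : Fin K ⊕ Σ i : Fin K, Σ j : Fin (s i), Fin (L i j)} :
    (GenModel K s L).Adj (Sum.inl i) w ↔
      (∃ i' : Fin K, ((i' : ℕ) = i + 1 ∨ (i : ℕ) = i' + 1) ∧ w = Sum.inl i') ∨
      ∃ (j : Fin (s i)) (h : 0 < L i j), w = Sum.inr ⟨i, j, ⟨0, h⟩⟩ := by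
  constructor
  · rcases w with i' | ⟨i', j, a⟩
    · rw [genModel_adj_inl_inl]
      exact fun h => Or.inl ⟨i', h, rfl⟩
    · rw [genModel_adj_inl_inr]
      rintro ⟨rfl, h⟩
      refine Or.inr ⟨j, by omega, ?_⟩
      congr
      exact Fin.ext h
  · rintro (⟨i', h, rfl⟩ | ⟨j, h, rfl⟩)
    · exact genModel_adj_inl_inl.2 h
    · exact genModel_adj_inl_inr.2 ⟨rfl, rfl⟩

lemma genModel_adj_inr_iff {i : Fin K} {j : Fin (s i)} {a : Fin (L i j)}
    {w : Fin K ⊕ Σ i : Fin K, Σ j : Fin (s i), Fin (L i j)} :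
    (GenModel K s L).Adj (Sum.inr ⟨i, j, a⟩) w ↔
      w = legPred L i j a ∨ ∃ h : (a : ℕ) + 1 < L i j, w = Sum.inr ⟨i, j, ⟨a + 1, h⟩⟩ := by
  constructor
  · rcases w with i' | ⟨i', j', a'⟩
    · rw [adj_comm, genModel_adj_inl_inr]
      rintro ⟨rfl, h⟩
      exact Or.inl (by simp [legPred, h])
    · rw [genModel_adj_inr_inr]
      rintro ⟨h1, h2, h3⟩
      have h1 := Fin.ext h1
      subst h1
      have h2 := Fin.ext h2
      subst h2
      rcases h3 with h3 | h3
      · refine Or.inr ⟨by omega, ?_⟩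
        congr
        exact Fin.ext h3
      · left
        rw [legPred, if_neg (by omega)]
        congr
        exact Fin.ext (by simp; omega)
  · rintro (rfl | ⟨h, rfl⟩)
    · unfold legPred
      split_ifs with h
      · rw [adj_comm]
        exact genModel_adj_inl_inr.2 ⟨rfl, h⟩
      · exact genModel_adj_inr_inr.2 ⟨rfl, rfl, Or.inr (by simp; omega)⟩
    · exact genModel_adj_inr_inr.2 ⟨rfl, rfl, Or.inl rfl⟩

lemma legPred_ne_succ {i : Fin K} {j : Fin (s i)} {a : Fin (L i j)} (h : (a : ℕ) + 1 < L i j) :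
    legPred L i j a ≠ Sum.inr ⟨i, j, ⟨a + 1, h⟩⟩ := by
  unfold legPred
  split_ifs with h0
  · simp
  · simp

lemma genModel_connected (hK : 1 ≤ K) : (GenModel K s L).Connected := by
  have h1 : ∀ n (hn : n < K), (GenModel K s L).Reachable (Sum.inl ⟨0, by omega⟩)
      (Sum.inl ⟨n, hn⟩) := by
    intro n
    induction n with
    | zero => intro hn; rfl
    | succ n ih =>
      intro hn
      exact (ih (by omega)).trans (genModel_adj_inl_inl.2 (Or.inl rfl)).reachable
  have h2 : ∀ i j n (hn : n < L i j), (GenModel K s L).Reachable (Sum.inl i)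
      (Sum.inr ⟨i, j, ⟨n, hn⟩⟩) := by
    intro i j n
    induction n with
    | zero => intro hn; exact (genModel_adj_inl_inr.2 ⟨rfl, rfl⟩).reachable
    | succ n ih =>
      intro hn
      exact (ih (by omega)).trans (genModel_adj_inr_inr.2 ⟨rfl, rfl, Or.inl rfl⟩).reachable
  rw [connected_iff_exists_forall_reachable]
  refine ⟨Sum.inl ⟨0, by omega⟩, ?_⟩
  rintro (i | ⟨i, j, a⟩)
  · exact h1 i i.2
  · exact (h1 i i.2).trans (h2 i j a a.2)

open scoped Classical in
lemma leafCount_genModel (hL : ∀ i j, 1 ≤ L i j)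
    (hc : ∀ i, ∃ w w', (GenModel K s L).Adj (Sum.inl i) w ∧ (GenModel K s L).Adj (Sum.inl i) w' ∧
      w ≠ w') : leafCount (GenModel K s L) = ∑ i, s i := by
  have : Fintype.card (Σ i : Fin K, Fin (s i)) = ∑ i, s i := by simp
  rw [← this, ← Finset.card_univ, leafCount]
  symm
  have not_leaf : ∀ v w w', (GenModel K s L).Adj v w → (GenModel K s L).Adj v w' → w ≠ w' →
      (GenModel K s L).degree v ≠ 1 := by
    intro v w w' h h' hne hd
    obtain ⟨z, -, hz⟩ := degree_eq_one_iff_existsUnique_adj.1 hd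
    exact hne ((hz w h).trans (hz w' h').symm)
  apply Finset.card_bij (fun x _ => Sum.inr ⟨x.1, x.2, ⟨L x.1 x.2 - 1, by
    have := hL x.1 x.2; omega⟩⟩)
  · rintro ⟨i, j⟩ -
    simp only [Finset.mem_filter, Finset.mem_univ, true_and]
    rw [degree_eq_one_iff_existsUnique_adj]
    refine ⟨legPred L i j ⟨L i j - 1, _⟩, genModel_adj_inr_iff.2 (Or.inl rfl), fun w hw => ?_⟩
    rcases genModel_adj_inr_iff.1 hw with h | ⟨h, -⟩
    · exact h
    · simp at h; omega
  · rintro ⟨i, j⟩ - ⟨i', j'⟩ - h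
    simp only [Sum.inr.injEq, Sigma.mk.injEq] at h
    obtain ⟨rfl, h⟩ := h
    simp only [heq_eq_eq, Sigma.mk.injEq] at h
    rw [h.1]
  · rintro (i | ⟨i, j, a⟩) h
    · obtain ⟨w, w', h1, h2, h3⟩ := hc i
      simp only [Finset.mem_filter, Finset.mem_univ, true_and] at h
      exact absurd h (not_leaf _ w w' h1 h2 h3)
    · simp only [Finset.mem_filter, Finset.mem_univ, true_and] at h
      refine ⟨⟨i, j⟩, Finset.mem_univ _, ?_⟩
      by_cases ha : (a : ℕ) + 1 < L i j
      · exact absurd h (not_leaf _ _ _ (genModel_adj_inr_iff.2 (Or.inl rfl))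
          (genModel_adj_inr_iff.2 (Or.inr ⟨ha, rfl⟩)) (legPred_ne_succ ha))
      · congr
        have := a.2
        change L i j - 1 = (a : ℕ)
        omega

open scoped Classical in
lemma degree_inr_le (i : Fin K) (j : Fin (s i)) (a : Fin (L i j)) :
    (GenModel K s L).degree (Sum.inr ⟨i, j, a⟩) ≤ 2 := by
  by_contra! hcon
  rw [← card_neighborFinset_eq_degree, Finset.two_lt_card] at hcon
  obtain ⟨x, hx, y, hy, z, hz, hxy, hxz, hyz⟩ := hcon
  rw [mem_neighborFinset, genModel_adj_inr_iff] at hx hy hz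
  rcases hx with rfl | ⟨_, rfl⟩ <;> rcases hy with rfl | ⟨_, rfl⟩ <;>
    rcases hz with rfl | ⟨_, rfl⟩ <;> simp_all

open scoped Classical in
lemma le_degree_inl (hL : ∀ i j, 1 ≤ L i j) (i : Fin K) :
    s i ≤ (GenModel K s L).degree (Sum.inl i) := by
  have h := Finset.card_le_card_of_injOn (s := (Finset.univ : Finset (Fin (s i))))
    (t := (GenModel K s L).neighborFinset (Sum.inl i))
    (fun j => Sum.inr ⟨i, j, ⟨0, hL i j⟩⟩) (by
      intro j _
      simpa using genModel_adj_inl_inr.2 ⟨rfl, rfl⟩) (by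
      intro j _ j' _ h
      simp only [Sum.inr.injEq, Sigma.mk.injEq, heq_eq_eq, true_and] at h
      exact h.1)
  simpa using h

open scoped Classical in
lemma succ_le_degree_inl (hL : ∀ i j, 1 ≤ L i j) (i i' : Fin K)
    (h : (i' : ℕ) = i + 1 ∨ (i : ℕ) = i' + 1) :
    s i + 1 ≤ (GenModel K s L).degree (Sum.inl i) := by
  have h := Finset.card_le_card_of_injOn (s := (Finset.univ : Finset (Option (Fin (s i)))))
    (t := (GenModel K s L).neighborFinset (Sum.inl i))
    (fun j => j.elim (Sum.inl i') fun j => Sum.inr ⟨i, j, ⟨0, hL i j⟩⟩) (by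
      rintro (_ | j) _
      · simpa using genModel_adj_inl_inl.2 h
      · simpa using genModel_adj_inl_inr.2 ⟨rfl, rfl⟩) (by
      rintro (_ | j) _ (_ | j') _ h
      · rfl
      · simp at h
      · simp at h
      · simp only [Option.elim_some, Sum.inr.injEq, Sigma.mk.injEq, heq_eq_eq, true_and] at h
        rw [h.1])
  simpa using h

lemma sum_eq_sum_filter_add (hK : 1 ≤ K) : ∑ i, s i =
    ∑ i ∈ Finset.univ.filter (fun i : Fin K => (i : ℕ) < K - 1), s i + s ⟨K - 1, by omega⟩ := by
  rw [← Finset.sum_filter_add_sum_filter_not Finset.univ (fun i : Fin K => (i : ℕ) < K - 1)]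
  congr 1
  have : Finset.univ.filter (fun i : Fin K => ¬ (i : ℕ) < K - 1) = {⟨K - 1, by omega⟩} := by
    ext i
    simp only [Finset.mem_filter, Finset.mem_univ, true_and, Finset.mem_singleton, Fin.ext_iff]
    omega
  rw [this, Finset.sum_singleton]

lemma two_neighbors_inl (hL : ∀ i j, 1 ≤ L i j) (hK : 2 ≤ K) (h0 : 1 ≤ s ⟨0, by omega⟩)
    (h1 : 1 ≤ s ⟨K - 1, by omega⟩) (i : Fin K) :
    ∃ w w', (GenModel K s L).Adj (Sum.inl i) w ∧ (GenModel K s L).Adj (Sum.inl i) w' ∧ w ≠ w' := by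
  obtain ⟨i, hi⟩ := i
  by_cases hi0 : i = 0
  · subst hi0
    exact ⟨Sum.inl ⟨1, by omega⟩, Sum.inr ⟨⟨0, hi⟩, ⟨0, h0⟩, ⟨0, hL _ _⟩⟩,
      genModel_adj_inl_inl.2 (Or.inl rfl), genModel_adj_inl_inr.2 ⟨rfl, rfl⟩, by simp⟩
  by_cases hi1 : i = K - 1
  · subst hi1
    exact ⟨Sum.inl ⟨K - 2, by omega⟩, Sum.inr ⟨⟨K - 1, hi⟩, ⟨0, h1⟩, ⟨0, hL _ _⟩⟩,
      genModel_adj_inl_inl.2 (Or.inr (by simp; omega)), genModel_adj_inl_inr.2 ⟨rfl, rfl⟩, by simp⟩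
  · exact ⟨Sum.inl ⟨i - 1, by omega⟩, Sum.inl ⟨i + 1, by omega⟩,
      genModel_adj_inl_inl.2 (Or.inr (by change i = i - 1 + 1; omega)),
      genModel_adj_inl_inl.2 (Or.inl rfl), by
        simp only [ne_eq, Sum.inl.injEq, Fin.mk.injEq]
        omega⟩

open scoped Classical in
lemma leafCount_eq_of_iso {W : Type*} [Fintype V] [Fintype W] {T : SimpleGraph V}
    {G : SimpleGraph W} (φ : T ≃g G) : leafCount T = leafCount G := by
  apply Finset.card_bij (fun v _ => φ v)
  · intro v hv
    simpa [φ.degree_eq] using hv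
  · intro v _ w _ h
    exact φ.injective h
  · intro w hw
    refine ⟨φ.symm w, ?_, by simp⟩
    simpa [φ.symm.degree_eq] using hw

open scoped Classical in
lemma exists_inl_of_branch [Fintype V] {T : SimpleGraph V} (φ : T ≃g GenModel K s L) {b : V}
    (hb : 3 ≤ T.degree b) : ∃ i, b = φ.symm (Sum.inl i) := by
  rcases h : φ b with i | ⟨i, j, a⟩
  · exact ⟨i, by rw [← h]; simp⟩
  · have h1 := degree_inr_le i j a
    have h2 := φ.degree_eq b
    rw [h] at h2
    omega

open scoped Classical in
lemma branch_path_of_inTFamily [Fintype V] {T : SimpleGraph V} (hT : T.IsTree)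
    (h : InTFamily T) : ∃ v, (∃ x, ∀ b, 3 ≤ T.degree b → OnGeod T v b x) ∧
      leafCount T + 2 ≤ 2 * T.degree v := by
  rcases h with ⟨n, hn, ⟨φ⟩⟩ | ⟨K, hK, s, L, hL, h0, hsum, ⟨φ⟩⟩
  · refine ⟨φ.symm (Sum.inl 0), ⟨φ.symm (Sum.inl 0), ?_⟩, ?_⟩
    · intro b hb
      obtain ⟨i, rfl⟩ := exists_inl_of_branch φ hb
      rw [Subsingleton.elim i 0]
      exact onGeod_left _ _
    · rw [leafCount_eq_of_iso φ, leafCount_genModel (by simp) (by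
        intro i
        refine ⟨Sum.inr ⟨i, ⟨0, by omega⟩, ⟨0, by simp⟩⟩, Sum.inr ⟨i, ⟨1, by omega⟩, ⟨0, by simp⟩⟩,
          genModel_adj_inl_inr.2 ⟨rfl, rfl⟩, genModel_adj_inl_inr.2 ⟨rfl, rfl⟩, by simp⟩)]
      have h1 := le_degree_inl (K := 1) (s := fun _ => n) (L := fun _ _ => 1) (by simp) 0
      rw [φ.symm.degree_eq, Fin.sum_univ_one]
      omega
  · have hK1 : 1 ≤ s ⟨K - 1, by omega⟩ := by
      refine h0.trans (le_trans ?_ hsum)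
      exact Finset.single_le_sum (f := s) (fun _ _ => Nat.zero_le _) (by simp; omega)
    refine ⟨φ.symm (Sum.inl ⟨K - 1, by omega⟩), ⟨φ.symm (Sum.inl ⟨0, by omega⟩), ?_⟩, ?_⟩
    · intro b hb
      obtain ⟨i, rfl⟩ := exists_inl_of_branch φ hb
      have := onGeod_of_nonbacktracking hT
        (fun n => φ.symm (Sum.inl ⟨K - 1 - n, by omega⟩)) (K - 1)
        (fun n hn => by
          rw [φ.symm.map_adj_iff, genModel_adj_inl_inl]
          right; simp; omega)
        (fun n hn heq => by
          have := φ.symm.injective heq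
          simp only [Sum.inl.injEq, Fin.mk.injEq] at this
          omega) (i := K - 1 - i) (by omega)
      have e : K - 1 - (K - 1 - (i : ℕ)) = i := by omega
      simpa [e] using this
    · rw [leafCount_eq_of_iso φ, leafCount_genModel hL (two_neighbors_inl hL hK h0 hK1),
        sum_eq_sum_filter_add (by omega), φ.symm.degree_eq]
      have h1 := succ_le_degree_inl hL ⟨K - 1, by omega⟩ ⟨K - 2, by omega⟩ (by simp; omega)
      omega

end Model

section Construction

variable {T : SimpleGraph V}

lemma nonempty_iso_genModel (hT : T.IsTree) {K : ℕ} (hK : 1 ≤ K) {s : Fin K → ℕ}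
    {L : (i : Fin K) → Fin (s i) → ℕ} (hL : ∀ i j, 1 ≤ L i j) (u : Fin K → V)
    (w : (i : Fin K) → Fin (s i) → ℕ → V)
    (hu : ∀ i i' : Fin K, (i' : ℕ) = i + 1 → T.Adj (u i) (u i'))
    (hw0 : ∀ i j, w i j 0 = u i)
    (hw : ∀ i j a, a < L i j → T.Adj (w i j a) (w i j (a + 1)))
    (hw2 : ∀ i j a, a + 2 ≤ L i j → w i j a ≠ w i j (a + 2))
    (hwn : ∀ i j a, a < L i j → ∀ z, T.Adj (w i j (a + 1)) z →
      z = w i j a ∨ (a + 1 < L i j ∧ z = w i j (a + 2)))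
    (hun : ∀ i z, T.Adj (u i) z →
      (∃ i' : Fin K, ((i' : ℕ) = i + 1 ∨ (i : ℕ) = i' + 1) ∧ z = u i') ∨ ∃ j, z = w i j 1)
    (hui : Function.Injective u) (hwi : ∀ i j j', w i j 1 = w i j' 1 → j = j')
    (hne : ∀ i j i', w i j 1 ≠ u i') : Nonempty (T ≃g GenModel K s L) := by
  set f : (Fin K ⊕ Σ i : Fin K, Σ j : Fin (s i), Fin (L i j)) → V :=
    Sum.elim u fun x => w x.1 x.2.1 (x.2.2 + 1) with hf
  have hfl : ∀ i, f (Sum.inl i) = u i := fun _ => rfl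
  have hfr : ∀ i j a, f (Sum.inr ⟨i, j, a⟩) = w i j (a + 1) := fun _ _ _ => rfl
  have hfp : ∀ i j a, f (legPred L i j a) = w i j a := by
    intro i j a
    unfold legPred
    split_ifs with h
    · rw [hfl, h, hw0]
    · rw [hfr]
      congr 1
      change (a : ℕ) - 1 + 1 = a
      omega
  refine nonempty_iso_of_covering hT (genModel_connected hK) f ?_ ?_ ?_
  · rintro (i | ⟨i, j, a⟩) b hab
    · rcases genModel_adj_inl_iff.1 hab with ⟨i', h | h, rfl⟩ | ⟨j, h, rfl⟩
      · exact hu _ _ h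
      · exact (hu _ _ h).symm
      · rw [hfl, hfr, ← hw0 i j]
        exact hw i j 0 h
    · rcases genModel_adj_inr_iff.1 hab with rfl | ⟨h, rfl⟩
      · rw [hfp, hfr]
        exact (hw i j a a.2).symm
      · rw [hfr, hfr]
        exact hw i j _ h
  · rintro (i | ⟨i, j, a⟩) b c hb hc hbc
    · rcases genModel_adj_inl_iff.1 hb with ⟨i', -, rfl⟩ | ⟨j, hj, rfl⟩ <;>
        rcases genModel_adj_inl_iff.1 hc with ⟨i'', -, rfl⟩ | ⟨j', hj', rfl⟩
      · rw [hui hbc]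
      · exact absurd hbc.symm (hne _ _ _)
      · exact absurd hbc (hne _ _ _)
      · have := hwi i j j' hbc
        subst this
        rfl
    · rcases genModel_adj_inr_iff.1 hb with rfl | ⟨h, rfl⟩ <;>
        rcases genModel_adj_inr_iff.1 hc with rfl | ⟨h', rfl⟩
      · rfl
      · rw [hfp, hfr] at hbc
        exact absurd hbc (hw2 i j a (by omega))
      · rw [hfp, hfr] at hbc
        exact absurd hbc.symm (hw2 i j a (by omega))
      · rfl
  · rintro (i | ⟨i, j, a⟩) z hz
    · rcases hun i z hz with ⟨i', h, rfl⟩ | ⟨j, rfl⟩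
      · exact ⟨Sum.inl i', genModel_adj_inl_inl.2 h, rfl⟩
      · exact ⟨Sum.inr ⟨i, j, ⟨0, hL i j⟩⟩, genModel_adj_inl_inr.2 ⟨rfl, rfl⟩, rfl⟩
    · rcases hwn i j a a.2 z hz with rfl | ⟨h, rfl⟩
      · exact ⟨_, genModel_adj_inr_iff.2 (Or.inl rfl), hfp _ _ _⟩
      · exact ⟨_, genModel_adj_inr_iff.2 (Or.inr ⟨h, rfl⟩), rfl⟩

open scoped Classical in
/-- A branch containing no vertex of degree at least `3` is a path. -/
lemma exists_leg [Fintype V] (hT : T.IsTree) {a q : V} (hq : T.Adj a q)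
    (hb : ∀ b, 3 ≤ T.degree b → ¬ OnGeod T a q b) : ∃ (n : ℕ) (p : ℕ → V), 1 ≤ n ∧ p 0 = a ∧
      p 1 = q ∧ (∀ k, k < n → T.Adj (p k) (p (k + 1))) ∧ (∀ k, k + 2 ≤ n → p k ≠ p (k + 2)) ∧
      ∀ k, k < n → ∀ z, T.Adj (p (k + 1)) z → z = p k ∨ (k + 1 < n ∧ z = p (k + 2)) := by
  obtain ⟨l, hl⟩ := leavesBeyond_nonempty hT hq.ne'
  rw [mem_leavesBeyond] at hl
  obtain ⟨hl1, hql⟩ := hl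
  obtain ⟨p, hp0, hpn, hadj, hgeo⟩ := exists_geodesic hT a l
  have hn : 1 ≤ T.dist a l := by
    rcases Nat.eq_zero_or_pos (T.dist a l) with h | h
    · rw [hT.connected.dist_eq_zero_iff] at h
      subst h
      exact absurd ((onGeod_self_iff hT).1 hql) hq.ne'
    · exact h
  have hp1 : p 1 = q := by
    have := hadj 0 hn
    rw [hp0] at this
    exact next_unique hT this hq (hgeo 1 hn).2 hql
  refine ⟨T.dist a l, p, hn, hp0, hp1, hadj, fun k hk heq => ?_, fun k hk z hz => ?_⟩
  · have h1 := (hgeo k (by omega)).1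
    have h2 := (hgeo (k + 2) (by omega)).1
    rw [heq] at h1
    omega
  · by_cases hk1 : k + 1 = T.dist a l
    · left
      rw [hk1, hpn] at hz
      have h2 := hadj k hk
      rw [hk1, hpn] at h2
      obtain ⟨y, -, hy⟩ := degree_eq_one_iff_existsUnique_adj.1 hl1
      exact (hy z hz).trans (hy _ h2.symm).symm
    · by_contra! hcon
      obtain ⟨h1, h2⟩ := hcon
      have h2 := h2 (by omega)
      have hne : p k ≠ p (k + 2) := by
        intro heq
        have h1 := (hgeo k (by omega)).1
        have h2 := (hgeo (k + 2) (by omega)).1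
        rw [heq] at h1
        omega
      refine hb _ (three_le_degree hz (hadj k hk).symm (hadj (k + 1) (by omega)) h1 h2 hne) ?_
      obtain ⟨h3, h4⟩ := hgeo (k + 1) (by omega)
      rcases onGeod_total hT hql h4 with h | h
      · exact h
      · rw [← h.eq_of_dist_le hT (by rw [h3, dist_eq_one_iff_adj.2 hq]; omega)]
        exact onGeod_right _ _

open scoped Classical in
lemma inTFamily_of_star [Fintype V] (hT : T.IsTree) {v : V} (hv : 2 ≤ T.degree v)
    (h : ∀ w, w ≠ v → T.Adj v w) : InTFamily T := by
  let e : Fin (T.degree v) ≃ T.neighborFinset v := (T.neighborFinset v).equivFin.symm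
  have he : ∀ j, T.Adj v (e j) := fun j => (mem_neighborFinset _ _ _).1 (e j).2
  refine Or.inl ⟨T.degree v, hv, nonempty_iso_genModel hT le_rfl (fun _ _ => le_rfl) (fun _ => v)
    (fun _ j a => if a = 0 then v else e j) ?_ ?_ ?_ ?_ ?_ ?_ ?_ ?_ ?_⟩
  · intro i i' h
    omega
  · intro _ _
    rfl
  · intro _ j a ha
    obtain rfl : a = 0 := by omega
    exact he j
  · intro _ _ _ h
    omega
  · intro _ j a ha z hz
    obtain rfl : a = 0 := by omega
    left
    by_contra hzv
    replace hz : T.Adj (e j) z := hz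
    replace hzv : z ≠ v := hzv
    have h1 := dist_eq_one_iff_adj.2 (h z hzv)
    have h2 := dist_eq_one_iff_adj.2 (he j)
    have := hT.dist_adj_cases v hz
    omega
  · intro _ z hz
    right
    refine ⟨e.symm ⟨z, by simpa using hz⟩, ?_⟩
    simp
  · intro i j _
    exact Subsingleton.elim i j
  · intro _ j j' h
    exact e.injective (Subtype.ext h)
  · intro _ j _
    exact (he j).ne'

open scoped Classical in
lemma inTFamily_of_far_leaf [Fintype V] (hT : T.IsTree) {v z : V} (hv : 2 ≤ T.degree v)
    (hz : T.degree z = 1) (hd : 2 ≤ T.dist v z) (hb : ∀ b, 3 ≤ T.degree b → OnGeod T v b z)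
    (hdeg : leafCount T + 2 ≤ 2 * T.degree v) : InTFamily T := by
  obtain ⟨p, hp0, hpn, hadj, hgeo⟩ := exists_geodesic hT v z
  obtain ⟨K, hK⟩ : ∃ K, K = T.dist v z := ⟨_, rfl⟩
  rw [← hK] at hpn hadj hgeo hd
  have hinj : ∀ i j, i ≤ K → j ≤ K → p i = p j → i = j := by
    intro i j hi hj h
    rw [← (hgeo i hi).1, ← (hgeo j hj).1, h]
  have hnear : ∀ i j, i ≤ K → j ≤ K → T.Adj (p i) (p j) → j = i + 1 ∨ i = j + 1 := by
    intro i j hi hj h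
    have := hT.dist_adj_cases v h
    rw [(hgeo i hi).1, (hgeo j hj).1] at this
    omega
  have hbtw : ∀ i j k, i ≤ j → j ≤ k → k ≤ K → OnGeod T (p i) (p j) (p k) := by
    intro i j k hij hjk hk
    have := onGeod_of_nonbacktracking hT (fun n => p (i + n)) (k - i)
      (fun n hn => hadj (i + n) (by omega))
      (fun n hn heq => by
        have := hinj _ _ (by omega) (by omega) heq
        omega) (i := j - i) (by omega)
    simpa [Nat.add_sub_cancel' hij, Nat.add_sub_cancel' (hij.trans hjk)] using this
  have hbranch : ∀ b, 3 ≤ T.degree b → ∃ k, k < K ∧ b = p k := by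
    intro b h3
    have h1 := hb b h3
    have hbK : T.dist v b ≤ K := by
      unfold OnGeod at h1
      omega
    have e := eq_of_onGeod_of_dist_eq hT h1 (hgeo _ hbK).2 (hgeo _ hbK).1.symm
    refine ⟨T.dist v b, lt_of_le_of_ne hbK fun h => ?_, e⟩
    rw [h, hpn] at e
    rw [e] at h3
    omega
  have hoff : ∀ m q, m < K → T.Adj (p m) q → (∀ k, k < K → q ≠ p k) →
      ∀ b, 3 ≤ T.degree b → ¬ OnGeod T (p m) q b := by
    intro m q hm hq hne b h3 hon
    obtain ⟨k, hk, rfl⟩ := hbranch b h3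
    rcases lt_trichotomy m k with h | rfl | h
    · exact hne (m + 1) (by omega) (next_unique hT hq (hadj m hm) hon
        (hbtw m (m + 1) k (by omega) h hk.le))
    · exact hq.ne' ((onGeod_self_iff hT).1 hon)
    · have ha := hadj (m - 1) (by omega)
      rw [Nat.sub_add_cancel (by omega)] at ha
      exact hne (m - 1) (by omega) (next_unique hT hq ha.symm hon
        (hbtw k (m - 1) m (by omega) (by omega) hm.le).symm)
  let u : Fin K → V := fun i => p (K - 1 - i)
  let N : Fin K → Finset V := fun i =>
    Finset.univ.filter fun q => T.Adj (u i) q ∧ ∀ k, k < K → q ≠ p k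
  have hN : ∀ i q, q ∈ N i ↔ T.Adj (u i) q ∧ ∀ k, k < K → q ≠ p k := fun i q => by simp [N]
  let e : (i : Fin K) → Fin (N i).card ≃ N i := fun i => (N i).equivFin.symm
  have he : ∀ i j, T.Adj (u i) (e i j) ∧ ∀ k, k < K → (e i j : V) ≠ p k :=
    fun i j => (hN i _).1 (e i j).2
  have hleg := fun i j => exists_leg hT (he i j).1
    (hoff _ _ (by omega) (he i j).1 (he i j).2)
  choose L w hL hw0 hw1 hw hw2 hwn using hleg
  have hiso : Nonempty (T ≃g GenModel K (fun i => (N i).card) L) := by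
    refine nonempty_iso_genModel hT (by omega) hL u w ?_ hw0 hw hw2 hwn ?_ ?_ ?_ ?_
    · intro i i' h
      have := hadj (K - 1 - i') (by omega)
      rw [show K - 1 - (i' : ℕ) + 1 = K - 1 - i by omega] at this
      exact this.symm
    · intro i q hq
      by_cases h : ∃ k, k < K ∧ q = p k
      · obtain ⟨k, hk, rfl⟩ := h
        have := hnear _ _ (by omega) hk.le hq
        refine Or.inl ⟨⟨K - 1 - k, by omega⟩, ?_, ?_⟩
        · change K - 1 - k = i + 1 ∨ (i : ℕ) = K - 1 - k + 1
          omega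
        · change p k = p (K - 1 - (K - 1 - k))
          congr 1
          omega
      · push Not at h
        refine Or.inr ⟨(e i).symm ⟨q, (hN i q).2 ⟨hq, h⟩⟩, ?_⟩
        rw [hw1]
        simp
    · intro i i' h
      have := hinj _ _ (by omega) (by omega) h
      exact Fin.ext (by omega)
    · intro i j j' h
      rw [hw1, hw1] at h
      exact (e i).injective (Subtype.ext h)
    · intro i j i'
      rw [hw1]
      exact (he i j).2 _ (by omega)
  have h0 : 1 ≤ (N ⟨0, by omega⟩).card := by
    rw [Nat.one_le_iff_ne_zero, ← Nat.pos_iff_ne_zero, Finset.card_pos]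
    refine ⟨p K, (hN _ _).2 ⟨?_, fun k hk h => hk.ne' (hinj _ _ le_rfl hk.le h)⟩⟩
    have := hadj (K - 1) (by omega)
    rwa [Nat.sub_add_cancel (by omega)] at this
  have hlast : T.degree v ≤ (N ⟨K - 1, by omega⟩).card + 1 := by
    rw [← card_neighborFinset_eq_degree]
    refine (Finset.card_le_card ?_).trans (Finset.card_insert_le (p 1) _)
    intro q hq
    rw [mem_neighborFinset] at hq
    have huv : u ⟨K - 1, by omega⟩ = v := by simp [u, hp0]
    rw [Finset.mem_insert, hN, huv]
    by_cases h : ∃ k, k < K ∧ q = p k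
    · obtain ⟨k, hk, rfl⟩ := h
      rw [← hp0] at hq
      have := hnear 0 k (by omega) hk.le hq
      left
      congr 1
      omega
    · push Not at h
      exact Or.inr ⟨hq, h⟩
  refine Or.inr ⟨K, hd, fun i => (N i).card, L, hL, h0, ?_, hiso⟩
  obtain ⟨φ⟩ := hiso
  have hc := leafCount_eq_of_iso φ
  rw [leafCount_genModel hL (two_neighbors_inl hL hd h0 (by omega)),
    sum_eq_sum_filter_add (by omega)] at hc
  beta_reduce
  omega

open scoped Classical in
lemma inTFamily_of_branch_path [Fintype V] (hT : T.IsTree) {v x : V} (hv : 2 ≤ T.degree v)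
    (hxv : x ≠ v) (hx : T.degree x = 1) (hb : ∀ b, 3 ≤ T.degree b → OnGeod T v b x)
    (hdeg : leafCount T + 2 ≤ 2 * T.degree v) : InTFamily T := by
  by_cases hd : 2 ≤ T.dist v x
  · exact inTFamily_of_far_leaf hT hv hx hd hb hdeg
  have hbv : ∀ b, 3 ≤ T.degree b → b = v := by
    intro b h3
    have h1 := hb b h3
    have h2 : T.dist b x ≠ 0 := fun h => by
      rw [hT.connected.dist_eq_zero_iff] at h
      subst h
      omega
    unfold OnGeod at h1
    exact (hT.connected.dist_eq_zero_iff.1 (by omega : T.dist v b = 0)).symm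
  by_cases hw : ∃ w, 2 ≤ T.dist v w
  · obtain ⟨w, hw⟩ := hw
    obtain ⟨l, hl⟩ := leavesBeyond_nonempty hT (r := v) (a := w) (by rintro rfl; simp at hw)
    rw [mem_leavesBeyond] at hl
    refine inTFamily_of_far_leaf hT hv hl.1 ?_ (fun b h3 => ?_) hdeg
    · have := hl.2
      unfold OnGeod at this
      omega
    · rw [hbv b h3]
      exact onGeod_left _ _
  · push Not at hw
    refine inTFamily_of_star hT hv fun w hne => dist_eq_one_iff_adj.1 ?_
    have h1 := hw w
    have h2 : T.dist v w ≠ 0 := fun h => hne (hT.connected.dist_eq_zero_iff.1 h).symm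
    omega

end Construction

open scoped Classical in
lemma degree_le_maxDeg [Fintype V] {T : SimpleGraph V} (v : V) : T.degree v ≤ maxDeg T :=
  Finset.le_sup (f := fun v => T.degree v) (Finset.mem_univ v)

/-- For a tree `T` of order at least `3`, `gpg'(T) = ℓ(T) - Δ(T) + 2` iff `T ∈ 𝒯`. -/
theorem stmt_19 {V : Type*} [Fintype V] (T : SimpleGraph V) (hT : T.IsTree)
    (h3 : 3 ≤ Fintype.card V) :
    gpg' T = leafCount T - maxDeg T + 2 ↔ InTFamily T := by
  constructor
  · intro h
    obtain ⟨v, x, hv, hxv, hx, hb, hdeg⟩ := exists_branch_path_of_le_gpg' hT h3 h.ge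
    exact inTFamily_of_branch_path hT hv hxv hx hb hdeg
  · intro h
    obtain ⟨v, hb, hdeg⟩ := branch_path_of_inTFamily hT h
    have h1 := le_gpg'_of_branch_path hT h3 hb hdeg
    have h2 := degree_le_maxDeg (T := T) v
    exact le_antisymm (gpg'_le hT h3) (by omega)
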